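/- Assume K has at least three elements. Let V be a maximal linear subspace of M_n(K) with a trivial spectrum. Then there exist positive integers n_1,…,n_p with n_1+⋯+n_p = n and non-isotropic matrices P_k ∈ GL_{n_k}(K) (1 ≤ k ≤ p) such that V is similar to P_1·Alt_{n_1}(K) ∨ ⋯ ∨ P_p·Alt_{n_p}(K). Moreover, the integer p is uniquely determined by V and each P_k is uniquely determined by V up to congruence and multiplication by a non-zero scalar; conversely, if Q_k ∈ GL_{n_k}(K) is congruent to a non-zero scalar multiple of P_k for each k, then V is also similar to Q_1·Alt_{n_1}(K) ∨ ⋯ ∨ Q_p·Alt_{n_p}(K). -/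

import Mathlib

open Matrix

/-- The set of alternate matrices: those `A` with `Xᵀ A X = 0` for all `X`. -/
def altSet (K : Type*) [Field K] (n : ℕ) : Set (Matrix (Fin n) (Fin n) K) :=
  {A | ∀ X : Fin n → K, X ⬝ᵥ A.mulVec X = 0}

/-- A matrix `P` is non-isotropic if `Xᵀ P X ≠ 0` for every non-zero `X`. -/
def nonIsotropic {K : Type*} [Field K] {n : ℕ} (P : Matrix (Fin n) (Fin n) K) : Prop :=
  ∀ X : Fin n → K, X ≠ 0 → X ⬝ᵥ P.mulVec X ≠ 0

/-- A linear subspace of matrices has a trivial spectrum if no matrix of it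
possesses a non-zero invariant vector. -/
def TrivialSpectrum {K : Type*} [Field K] {n : ℕ} (V : Set (Matrix (Fin n) (Fin n) K)) : Prop :=
  ∀ M ∈ V, ∀ X : Fin n → K, M.mulVec X = X → X = 0

/-- `V ∨ W`: block upper-triangular matrices with diagonal blocks in `V` and `W` and
arbitrary upper-right block. -/
def blockJoin {K : Type*} [Field K] {n p : ℕ}
    (V : Set (Matrix (Fin n) (Fin n) K)) (W : Set (Matrix (Fin p) (Fin p) K)) :
    Set (Matrix (Fin (n + p)) (Fin (n + p)) K) :=
  {M | ∃ A ∈ V, ∃ C ∈ W, ∃ B : Matrix (Fin n) (Fin p) K,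
    M = Matrix.reindex finSumFinEquiv finSumFinEquiv (Matrix.fromBlocks A B 0 C)}

/-- Sum of the sizes in a list of (size, matrix) pairs. -/
def sigSum {β : ℕ → Type*} : List (Σ m : ℕ, β m) → ℕ
  | [] => 0
  | x :: xs => x.1 + sigSum xs

/-- `P_1·Alt_{n_1}(K) ∨ ⋯ ∨ P_p·Alt_{n_p}(K)` for a list of pairs `(n_k, P_k)`. -/
def bdSet {K : Type*} [Field K] :
    (l : List (Σ m : ℕ, Matrix (Fin m) (Fin m) K)) →
      Set (Matrix (Fin (sigSum l)) (Fin (sigSum l)) K)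
  | [] => Set.univ
  | x :: xs => blockJoin ((fun A => x.2 * A) '' altSet K x.1) (bdSet xs)

/-- Two subspaces of `M_n(K)` are similar if one is obtained from the other by conjugation. -/
def SimilarSets {K : Type*} [Field K] {n : ℕ}
    (V W : Set (Matrix (Fin n) (Fin n) K)) : Prop :=
  ∃ P : Matrix (Fin n) (Fin n) K, IsUnit P ∧ W = (fun M => P * M * P⁻¹) '' V

/-- `V` is represented by the list `l` of pairs `(n_k, P_k)`: the sizes are positive,
each `P_k` is an invertible non-isotropic matrix, the sizes sum to `n`, and `V` is
similar to `P_1·Alt_{n_1}(K) ∨ ⋯ ∨ P_p·Alt_{n_p}(K)`. -/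
def Represents {K : Type*} [Field K] {n : ℕ} (V : Submodule K (Matrix (Fin n) (Fin n) K))
    (l : List (Σ m : ℕ, Matrix (Fin m) (Fin m) K)) : Prop :=
  (∀ x ∈ l, 0 < x.1 ∧ IsUnit x.2 ∧ nonIsotropic x.2) ∧
  ∃ h : sigSum l = n,
    SimilarSets ((Matrix.reindex (finCongr h) (finCongr h)) '' bdSet l)
      (V : Set (Matrix (Fin n) (Fin n) K))

/-- The two pairs have the same size, and the matrices are congruent up to a
non-zero scalar. -/
def congrScalar {K : Type*} [Field K] (x y : Σ m : ℕ, Matrix (Fin m) (Fin m) K) : Prop :=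
  ∃ h : x.1 = y.1, ∃ c : K, c ≠ 0 ∧ ∃ R : Matrix (Fin x.1) (Fin x.1) K, IsUnit R ∧
    Matrix.reindex (finCongr h.symm) (finCongr h.symm) y.2 = c • (R * x.2 * Rᵀ)

open Module

section Generic

variable {K : Type*} {E F : Type*} [Field K] [AddCommGroup E] [Module K E]
  [AddCommGroup F] [Module K F]

theorem finrank_map_add_finrank_inf_ker [FiniteDimensional K E] (f : E →ₗ[K] F)
    (p : Submodule K E) :
    finrank K (p.map f) + finrank K (p ⊓ LinearMap.ker f : Submodule K E) = finrank K p := by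
  have h := LinearMap.finrank_range_add_finrank_ker (f.domRestrict p)
  rw [LinearMap.range_domRestrict, LinearMap.ker_domRestrict] at h
  rw [← h]
  congr 1
  rw [← Submodule.map_comap_subtype]
  exact (LinearEquiv.finrank_eq
    (Submodule.equivMapOfInjective p.subtype p.injective_subtype _)).symm

theorem exists_notMem_two {G₁ G₂ : Submodule K E} (h₁ : G₁ ≠ ⊤) (h₂ : G₂ ≠ ⊤) :
    ∃ x, x ∉ G₁ ∧ x ∉ G₂ := by
  obtain ⟨u, -, hu⟩ := SetLike.exists_of_lt (lt_top_iff_ne_top.2 h₁)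
  obtain ⟨v, -, hv⟩ := SetLike.exists_of_lt (lt_top_iff_ne_top.2 h₂)
  by_cases hu2 : u ∈ G₂
  · by_cases hv1 : v ∈ G₁
    · refine ⟨u + v, fun h => hu ?_, fun h => hv ?_⟩
      · simpa using G₁.sub_mem h hv1
      · simpa using G₂.sub_mem h hu2
    · exact ⟨v, hv1, hv⟩
  · exact ⟨u, hu, hu2⟩

/-- If `u ∉ G`, at most one scalar `t` satisfies `v + t • u ∈ G`. -/
theorem eq_of_add_smul_mem {G : Submodule K E} {u v : E} (hu : u ∉ G) {s t : K}
    (hs : v + s • u ∈ G) (ht : v + t • u ∈ G) : s = t := by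
  by_contra hst
  apply hu
  have h := G.sub_mem hs ht
  have h2 : v + s • u - (v + t • u) = (s - t) • u := by module
  rw [h2] at h
  exact (G.smul_mem_iff (sub_ne_zero.2 hst)).1 h

/-- If `u ∉ G`, some non-zero scalar `t` satisfies `v + t • u ∉ G`. -/
theorem exists_ne_zero_add_smul_notMem (hK : ∃ a : K, a ≠ 0 ∧ a ≠ 1) {G : Submodule K E}
    {u : E} (v : E) (hu : u ∉ G) : ∃ t : K, t ≠ 0 ∧ v + t • u ∉ G := by
  obtain ⟨a, ha0, ha1⟩ := hK
  by_cases h : v + a • u ∈ G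
  · exact ⟨1, one_ne_zero, fun h1 => ha1 (eq_of_add_smul_mem hu h h1)⟩
  · exact ⟨a, ha0, h⟩

theorem exists_notMem_three (hK : ∃ a : K, a ≠ 0 ∧ a ≠ 1) {G₁ G₂ G₃ : Submodule K E}
    (h₁ : G₁ ≠ ⊤) (h₂ : G₂ ≠ ⊤) (h₃ : G₃ ≠ ⊤) : ∃ x, x ∉ G₁ ∧ x ∉ G₂ ∧ x ∉ G₃ := by
  obtain ⟨v, hv1, hv2⟩ := exists_notMem_two h₁ h₂
  by_cases hv3 : v ∈ G₃
  swap
  · exact ⟨v, hv1, hv2, hv3⟩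
  obtain ⟨u, -, hu⟩ := SetLike.exists_of_lt (lt_top_iff_ne_top.2 h₃)
  have key : ∀ t : K, t ≠ 0 → v + t • u ∉ G₃ := fun t ht h => by
    apply hu
    have := G₃.sub_mem h hv3
    rw [add_sub_cancel_left] at this
    exact (G₃.smul_mem_iff ht).1 this
  by_cases hu1 : u ∈ G₁
  · have h1 : ∀ t : K, v + t • u ∉ G₁ := fun t h => hv1 (by
      simpa using G₁.sub_mem h (G₁.smul_mem t hu1))
    by_cases hu2 : u ∈ G₂
    · exact ⟨v + (1 : K) • u, h1 _, fun h => hv2 (by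
        simpa using G₂.sub_mem h (G₂.smul_mem 1 hu2)), key _ one_ne_zero⟩
    · obtain ⟨t, ht, h⟩ := exists_ne_zero_add_smul_notMem hK v hu2
      exact ⟨_, h1 t, h, key t ht⟩
  · by_cases hu2 : u ∈ G₂
    · obtain ⟨t, ht, h⟩ := exists_ne_zero_add_smul_notMem hK v hu1
      exact ⟨_, h, fun h => hv2 (by
        simpa using G₂.sub_mem h (G₂.smul_mem t hu2)), key t ht⟩
    · exact ⟨u, hu1, hu2, hu⟩

theorem exists_smul_eq_of_finrank_add_one [FiniteDimensional K E] {W : Submodule K E}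
    (hW : finrank K W + 1 = finrank K E) {f g : E →ₗ[K] K} (hf0 : f ≠ 0)
    (hf : ∀ w ∈ W, f w = 0) (hg : ∀ w ∈ W, g w = 0) : ∃ c : K, g = c • f := by
  have h1 : finrank K W.dualAnnihilator = 1 := by
    have := Subspace.finrank_add_finrank_dualAnnihilator_eq W
    omega
  have hf' : f ∈ W.dualAnnihilator := (Submodule.mem_dualAnnihilator f).2 hf
  have hg' : g ∈ W.dualAnnihilator := (Submodule.mem_dualAnnihilator g).2 hg
  obtain ⟨c, hc⟩ := (finrank_eq_one_iff_of_nonzero' (⟨f, hf'⟩ : W.dualAnnihilator)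
    (by simpa [Subtype.ext_iff] using hf0)).1 h1 ⟨g, hg'⟩
  exact ⟨c, by simpa using (congrArg Subtype.val hc).symm⟩

theorem exists_add_smul_eq_of_finrank_add_two [FiniteDimensional K E] {W : Submodule K E}
    (hW : finrank K W + 2 = finrank K E) {f g h : E →ₗ[K] K} (hf0 : f ≠ 0)
    (hfg : ∀ c : K, g ≠ c • f) (hf : ∀ w ∈ W, f w = 0) (hg : ∀ w ∈ W, g w = 0)
    (hh : ∀ w ∈ W, h w = 0) : ∃ a b : K, h = a • f + b • g := by
  have h1 : finrank K W.dualAnnihilator = 2 := by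
    have := Subspace.finrank_add_finrank_dualAnnihilator_eq W
    omega
  have hf' : f ∈ W.dualAnnihilator := (Submodule.mem_dualAnnihilator f).2 hf
  have hg' : g ∈ W.dualAnnihilator := (Submodule.mem_dualAnnihilator g).2 hg
  have hli : LinearIndependent K ![f, g] :=
    (LinearIndependent.pair_iff' hf0).2 fun a ha => hfg a ha.symm
  have hle : Submodule.span K (Set.range ![f, g]) ≤ W.dualAnnihilator := by
    rw [Submodule.span_le]
    rintro _ ⟨i, rfl⟩
    fin_cases i
    exacts [hf', hg']
  have heq := Submodule.eq_of_le_of_finrank_eq hle (by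
    rw [finrank_span_eq_card hli, h1, Fintype.card_fin])
  have hh' : h ∈ W.dualAnnihilator := (Submodule.mem_dualAnnihilator h).2 hh
  rw [← heq, Matrix.range_cons, Matrix.range_cons, Matrix.range_empty, Set.union_empty,
    Set.singleton_union, Submodule.mem_span_pair] at hh'
  obtain ⟨a, b, hab⟩ := hh'
  exact ⟨a, b, hab.symm⟩

theorem exists_form_of_notMem {G : Submodule K E} {x : E} (hx : x ∉ G) :
    ∃ f : E →ₗ[K] K, f x = 1 ∧ ∀ g ∈ G, f g = 0 := by
  obtain ⟨f, hf, hG⟩ := Submodule.exists_le_ker_of_notMem hx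
  exact ⟨(f x)⁻¹ • f, by simp [hf], fun g hg => by simp [LinearMap.mem_ker.1 (hG hg)]⟩

theorem ker_ne_top_of_apply_ne_zero {f : E →ₗ[K] F} {x : E} (h : f x ≠ 0) :
    LinearMap.ker f ≠ ⊤ := fun h2 => h (LinearMap.mem_ker.1 (h2 ▸ Submodule.mem_top))

/-- A finite relation with non-empty rows contains a non-empty square sub-relation whose
rows have exactly one element each. -/
theorem exists_finset_existsUnique {ι : Type*} [Finite ι] [Nonempty ι] (r : ι → ι → Prop)
    (hr : ∀ i, ∃ j, r i j) :
    ∃ S : Finset ι, S.Nonempty ∧ ∀ i ∈ S, ∃ j ∈ S, r i j ∧ ∀ k ∈ S, r i k → k = j := by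
  classical
  cases nonempty_fintype ι
  obtain ⟨S, hS⟩ := exists_minimal_of_wellFoundedLT
    (fun S : Finset ι => S.Nonempty ∧ ∀ i ∈ S, ∃ j ∈ S, r i j)
    ⟨Finset.univ, Finset.univ_nonempty, fun i _ => by simpa using hr i⟩
  have key : ∀ j ∈ S, ∃ i ∈ S, r i j ∧ ∀ k ∈ S, r i k → k = j := by
    intro j hj
    by_cases hne : (S.erase j).Nonempty
    · have h := hS.not_prop_of_lt (Finset.erase_ssubset hj)
      simp only [hne, true_and, not_forall] at h
      obtain ⟨i, hi, hij⟩ := h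
      have hiS := Finset.mem_of_mem_erase hi
      have huniq : ∀ k ∈ S, r i k → k = j := fun k hk hik => by
        by_contra hkj
        exact hij ⟨k, Finset.mem_erase.2 ⟨hkj, hk⟩, hik⟩
      obtain ⟨k, hk, hik⟩ := hS.prop.2 i hiS
      exact ⟨i, hiS, huniq k hk hik ▸ hik, huniq⟩
    · have hall : ∀ k ∈ S, k = j := fun k hk => by
        by_contra hkj
        exact hne ⟨k, Finset.mem_erase.2 ⟨hkj, hk⟩⟩
      obtain ⟨k, hk, hjk⟩ := hS.prop.2 j hj
      exact ⟨j, hj, hall k hk ▸ hjk, fun k hk _ => hall k hk⟩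
  choose! τ hτS hτ hτu using key
  refine ⟨S, hS.prop.1, fun i hi => ?_⟩
  obtain ⟨j, hj, rfl⟩ := Finset.surj_on_of_inj_on_of_card_le (fun j _ => τ j) hτS
    (fun a b ha hb hab => by
      have h1 := hτ a ha
      rw [hab] at h1
      exact hτu b hb a ha h1) le_rfl i hi
  exact ⟨j, hj, hτ j hj, hτu j hj⟩

end Generic

/-- A space of endomorphisms none of which has a non-zero invariant vector. -/
def IsTS {K E : Type*} [Field K] [AddCommGroup E] [Module K E]
    (V : Submodule K (End K E)) : Prop :=
  ∀ M ∈ V, ∀ x, M x = x → x = 0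

/-- A trivial-spectrum space of the greatest possible dimension. -/
def IsMaxTS {K E : Type*} [Field K] [AddCommGroup E] [Module K E]
    (V : Submodule K (End K E)) : Prop :=
  IsTS V ∧ finrank K V = (finrank K E).choose 2

section Defs

variable {K E : Type*} [Field K] [AddCommGroup E] [Module K E]

/-- The span of the ranges of the rank-one elements of `V`. -/
def rankOneSpan (V : Submodule K (End K E)) : Submodule K E :=
  Submodule.span K {x | ∃ f : E →ₗ[K] K, f ≠ 0 ∧ f.smulRight x ∈ V}

/-- The space `V x`. -/
def orbitAt (V : Submodule K (End K E)) (x : E) : Submodule K E :=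
  V.map (LinearMap.applyₗ x)

/-- The elements of `V` that vanish at `x`. -/
def stabAt (V : Submodule K (End K E)) (x : E) : Submodule K (End K E) :=
  V ⊓ LinearMap.ker (LinearMap.applyₗ x)

/-- The endomorphisms of `E ⧸ G` induced by elements of `W`. -/
def quotEnd (G : Submodule K E) (W : Submodule K (End K E)) : Submodule K (End K (E ⧸ G)) :=
  (W.map (LinearMap.compRight K G.mkQ)).comap (LinearMap.lcomp K (E ⧸ G) G.mkQ)

/-- The endomorphisms of `G` induced by elements of `W`. -/
def restrEnd (G : Submodule K E) (W : Submodule K (End K E)) : Submodule K (End K G) :=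
  (W.map (LinearMap.lcomp K E G.subtype)).comap (LinearMap.compRight K G.subtype)

variable {V : Submodule K (End K E)} {G : Submodule K E}

theorem mem_quotEnd {N : End K (E ⧸ G)} :
    N ∈ quotEnd G V ↔ ∃ M ∈ V, ∀ x, G.mkQ (M x) = N (G.mkQ x) := by
  simp only [quotEnd, Submodule.mem_comap, Submodule.mem_map, LinearMap.ext_iff]
  rfl

theorem mem_restrEnd {N : End K G} :
    N ∈ restrEnd G V ↔ ∃ M ∈ V, ∀ x : G, M x = N x := by
  simp only [restrEnd, Submodule.mem_comap, Submodule.mem_map, LinearMap.ext_iff]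
  rfl


theorem IsTS.mono {W : Submodule K (End K E)} (hV : IsTS V) (h : W ≤ V) : IsTS W :=
  fun M hM => hV M (h hM)

theorem IsTS.isTS_quotEnd [FiniteDimensional K E] (hV : IsTS V)
    (hG : ∀ M ∈ V, ∀ x ∈ G, M x ∈ G) : IsTS (quotEnd G V) := by
  intro N hN x hx
  obtain ⟨M, hM, hMN⟩ := mem_quotEnd.1 hN
  obtain ⟨x, rfl⟩ := G.mkQ_surjective x
  rw [← hMN] at hx
  have hT : ∀ g ∈ G, (M - 1) g ∈ G := fun g hg => G.sub_mem (hG M hM g hg) hg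
  have hinj : Function.Injective ((M - 1).restrict hT) := by
    rw [← LinearMap.ker_eq_bot, LinearMap.ker_eq_bot']
    intro g hg
    have h1 : M g - g = 0 := congrArg Subtype.val hg
    exact Subtype.ext (hV M hM g (sub_eq_zero.1 h1))
  have hxG : M x - x ∈ G := (Submodule.Quotient.eq G).1 hx
  obtain ⟨g, hg⟩ := (LinearMap.injective_iff_surjective.1 hinj) ⟨M x - x, hxG⟩
  have h1 : M g - g = M x - x := congrArg Subtype.val hg
  have h2 : x - g = 0 := hV M hM _ (by
    rw [map_sub, sub_eq_sub_iff_add_eq_add, add_comm, ← sub_eq_sub_iff_add_eq_add]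
    rw [sub_eq_sub_iff_add_eq_add] at h1 ⊢
    rw [add_comm x, h1, add_comm])
  rw [sub_eq_zero] at h2
  rw [h2]
  simp

theorem IsTS.isTS_restrEnd (hV : IsTS V) : IsTS (restrEnd G V) := by
  intro N hN x hx
  obtain ⟨M, hM, hMN⟩ := mem_restrEnd.1 hN
  exact Subtype.ext (hV M hM x (by rw [hMN, hx]))

theorem IsTS.rankOneSpan_ne_top [FiniteDimensional K E] [Nontrivial E] (hV : IsTS V) :
    rankOneSpan V ≠ ⊤ := by
  classical
  intro h
  let b := Basis.ofSpan h.ge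
  have hb : ∀ i, ∃ f : E →ₗ[K] K, f ≠ 0 ∧ f.smulRight (b i) ∈ V := fun i =>
    Basis.ofSpan_subset h.ge ⟨i, rfl⟩
  choose f hf0 hfV using hb
  have := b.index_nonempty
  have : Finite _ := Module.Finite.finite_basis b
  obtain ⟨S, ⟨i₀, hi₀⟩, hS⟩ := exists_finset_existsUnique (fun i j => f i (b j) ≠ 0) (fun i => by
    by_contra! hc
    exact hf0 i (b.ext (by simpa using hc)))
  have hx : ∀ i ∈ S, f i (∑ j ∈ S, b j) ≠ 0 := fun i hi => by
    obtain ⟨j, hj, hij, hju⟩ := hS i hi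
    rw [map_sum, Finset.sum_eq_single_of_mem j hj fun k hk hkj => by
      by_contra hik
      exact hkj (hju k hk hik)]
    exact hij
  have h0 := hV (∑ i ∈ S, (f i (∑ j ∈ S, b j))⁻¹ • (f i).smulRight (b i))
    (V.sum_mem fun i _ => V.smul_mem _ (hfV i)) (∑ j ∈ S, b j) (by
      rw [LinearMap.sum_apply]
      refine Finset.sum_congr rfl fun i hi => ?_
      rw [LinearMap.smul_apply, LinearMap.smulRight_apply, smul_smul, inv_mul_cancel₀ (hx i hi),
        one_smul])
  exact hx i₀ hi₀ (by rw [h0, map_zero])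

end Defs

section MaxTS

variable {K E : Type*} [Field K] [AddCommGroup E] [Module K E]
variable {V : Submodule K (End K E)} {G : Submodule K E}

theorem mem_ker_lcomp_subtype {M : End K E} :
    M ∈ LinearMap.ker (LinearMap.lcomp K E G.subtype) ↔ ∀ x ∈ G, M x = 0 := by
  simp [LinearMap.ext_iff]

theorem mem_ker_compRight_mkQ {M : End K E} :
    M ∈ LinearMap.ker (LinearMap.compRight K G.mkQ : End K E →ₗ[K] _) ↔ ∀ x, M x ∈ G := by
  simp [LinearMap.ext_iff]

theorem restrEnd_mono {W : Submodule K (End K E)} (h : W ≤ V) : restrEnd G W ≤ restrEnd G V :=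
  Submodule.comap_mono (Submodule.map_mono h)

theorem map_restrEnd (hG : ∀ M ∈ V, ∀ x ∈ G, M x ∈ G) :
    (restrEnd G V).map (LinearMap.compRight K G.subtype) =
      V.map (LinearMap.lcomp K E G.subtype) := by
  rw [restrEnd, Submodule.map_comap_eq, inf_eq_right]
  rintro _ ⟨M, hM, rfl⟩
  exact ⟨M.restrict (hG M hM), rfl⟩

theorem map_quotEnd (hG : ∀ M ∈ V, ∀ x ∈ G, M x ∈ G) :
    (quotEnd G V).map (LinearMap.lcomp K (E ⧸ G) G.mkQ) =
      V.map (LinearMap.compRight K G.mkQ) := by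
  rw [quotEnd, Submodule.map_comap_eq, inf_eq_right]
  rintro _ ⟨M, hM, rfl⟩
  exact ⟨G.mapQ G M (hG M hM), rfl⟩

theorem finrank_map_quotEnd :
    finrank K ((quotEnd G V).map (LinearMap.lcomp K (E ⧸ G) G.mkQ)) =
      finrank K (quotEnd G V) :=
  (LinearEquiv.finrank_eq (Submodule.equivMapOfInjective _
    (fun _ _ h => LinearMap.ext fun x => by
      obtain ⟨x, rfl⟩ := G.mkQ_surjective x
      exact LinearMap.congr_fun h x) _)).symm

theorem finrank_map_restrEnd :
    finrank K ((restrEnd G V).map (LinearMap.compRight K G.subtype)) =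
      finrank K (restrEnd G V) :=
  (LinearEquiv.finrank_eq (Submodule.equivMapOfInjective _
    (fun _ _ h => LinearMap.ext fun x => Subtype.ext (LinearMap.congr_fun h x)) _)).symm

theorem finrank_restrEnd [FiniteDimensional K E] (hG : ∀ M ∈ V, ∀ x ∈ G, M x ∈ G) :
    finrank K (restrEnd G V) +
      finrank K (V ⊓ LinearMap.ker (LinearMap.lcomp K E G.subtype) : Submodule K (End K E)) =
      finrank K V := by
  rw [← finrank_map_restrEnd, map_restrEnd hG, finrank_map_add_finrank_inf_ker]

theorem finrank_quotEnd [FiniteDimensional K E] (hG : ∀ M ∈ V, ∀ x ∈ G, M x ∈ G) :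
    finrank K (quotEnd G V) +
      finrank K (V ⊓ LinearMap.ker (LinearMap.compRight K G.mkQ) : Submodule K (End K E)) =
      finrank K V := by
  rw [← finrank_map_quotEnd, map_quotEnd hG, finrank_map_add_finrank_inf_ker]

theorem apply_mem_span_of_mem_stabAt {y : E} :
    ∀ M ∈ stabAt V y, ∀ x ∈ K ∙ y, M x ∈ K ∙ y := by
  rintro M ⟨-, hM⟩ x hx
  obtain ⟨c, rfl⟩ := Submodule.mem_span_singleton.1 hx
  rw [map_smul, show M y = 0 from hM, smul_zero]
  exact zero_mem _

theorem smulRight_mem_imp {x : E} {f : E →ₗ[K] K} (hf : f ≠ 0) (h : f.smulRight x ∈ V) :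
    x ∈ rankOneSpan V :=
  Submodule.subset_span ⟨f, hf, h⟩

theorem ne_zero_of_notMem_rankOneSpan {y : E} (hy : y ∉ rankOneSpan V) : y ≠ 0 := fun h =>
  hy (h ▸ zero_mem _)

theorem finrank_quotEnd_stabAt [FiniteDimensional K E] {y : E} (hy : y ∉ rankOneSpan V) :
    finrank K (quotEnd (K ∙ y) (stabAt V y)) = finrank K (stabAt V y) := by
  rw [← finrank_quotEnd (apply_mem_span_of_mem_stabAt (V := V) (y := y))]
  have h0 := ne_zero_of_notMem_rankOneSpan hy
  obtain ⟨g, hg, -⟩ := exists_form_of_notMem (K := K) (G := ⊥) (x := y) (by simpa using h0)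
  suffices h : stabAt V y ⊓ LinearMap.ker (LinearMap.compRight K (K ∙ y).mkQ) = ⊥ by
    rw [h, finrank_bot, add_zero]
  rw [eq_bot_iff]
  rintro M ⟨hM, hMy⟩
  rw [SetLike.mem_coe, mem_ker_compRight_mkQ] at hMy
  have hM2 : M = (g ∘ₗ M).smulRight y := LinearMap.ext fun x => by
    obtain ⟨c, hc⟩ := Submodule.mem_span_singleton.1 (hMy x)
    simp [← hc, hg]
  by_contra hM0
  refine hy (smulRight_mem_imp (f := g ∘ₗ M) (fun h => hM0 ?_) (hM2 ▸ hM.1))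
  rw [hM2, h]
  simp

theorem finrank_orbitAt_add [FiniteDimensional K E] (V : Submodule K (End K E)) (y : E) :
    finrank K (orbitAt V y) + finrank K (stabAt V y) = finrank K V :=
  finrank_map_add_finrank_inf_ker _ _

theorem IsTS.notMem_orbitAt (hV : IsTS V) {y : E} (hy : y ≠ 0) : y ∉ orbitAt V y := by
  rintro ⟨M, hM, h⟩
  exact hy (hV M hM y h)

theorem IsTS.finrank_orbitAt_lt [FiniteDimensional K E] (hV : IsTS V) {y : E} (hy : y ≠ 0) :
    finrank K (orbitAt V y) < finrank K E :=
  Submodule.finrank_lt fun h => hV.notMem_orbitAt hy (h ▸ Submodule.mem_top)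

theorem finrank_quotient_span_singleton_add_one [FiniteDimensional K E] {y : E} (hy : y ≠ 0) :
    finrank K (E ⧸ K ∙ y) + 1 = finrank K E := by
  rw [← Submodule.finrank_quotient_add_finrank (K ∙ y), finrank_span_singleton hy]

theorem IsTS.quotEnd_stabAt [FiniteDimensional K E] (hV : IsTS V) (y : E) :
    IsTS (quotEnd (K ∙ y) (stabAt V y)) :=
  (hV.mono inf_le_left).isTS_quotEnd apply_mem_span_of_mem_stabAt

theorem choose_two_succ (m : ℕ) : (m + 1).choose 2 = m + m.choose 2 := by
  rw [Nat.choose_succ_succ' m 1, Nat.choose_one_right]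

theorem IsTS.finrank_le_aux {K : Type*} [Field K] (n : ℕ) : ∀ (E : Type*) [AddCommGroup E]
    [Module K E] [FiniteDimensional K E] (V : Submodule K (End K E)), IsTS V →
    finrank K E = n → finrank K V ≤ n.choose 2 := by
  induction n with
  | zero =>
    intro E _ _ _ V _ hn
    have := Submodule.finrank_le V
    rw [finrank_linearMap, hn] at this
    simpa using this
  | succ n ih =>
    intro E _ _ _ V hV hn
    have : Nontrivial E := finrank_pos_iff (R := K).1 (by omega)
    obtain ⟨y, -, hy⟩ := SetLike.exists_of_lt (lt_top_iff_ne_top.2 hV.rankOneSpan_ne_top)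
    have h0 := ne_zero_of_notMem_rankOneSpan hy
    have h1 := finrank_quotient_span_singleton_add_one (K := K) h0
    have h2 := ih _ _ (hV.quotEnd_stabAt y) (by omega)
    have h3 := hV.finrank_orbitAt_lt h0
    rw [finrank_quotEnd_stabAt hy] at h2
    rw [← finrank_orbitAt_add V y, choose_two_succ]
    omega

theorem IsTS.finrank_le [FiniteDimensional K E] (hV : IsTS V) :
    finrank K V ≤ (finrank K E).choose 2 :=
  IsTS.finrank_le_aux _ E V hV rfl

section Max

variable [FiniteDimensional K E] (hV : IsMaxTS V) {y : E} (hy : y ∉ rankOneSpan V)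
include hV hy

theorem IsMaxTS.finrank_orbitAt : finrank K (orbitAt V y) + 1 = finrank K E := by
  have h0 := ne_zero_of_notMem_rankOneSpan hy
  have h1 := finrank_quotient_span_singleton_add_one (K := K) h0
  have h2 := (hV.1.quotEnd_stabAt y).finrank_le
  have h3 := hV.1.finrank_orbitAt_lt h0
  have h4 := finrank_orbitAt_add V y
  rw [finrank_quotEnd_stabAt hy] at h2
  rw [hV.2, ← h1, choose_two_succ] at h4
  omega

theorem IsMaxTS.quotEnd_stabAt : IsMaxTS (quotEnd (K ∙ y) (stabAt V y)) := by
  refine ⟨hV.1.quotEnd_stabAt y, ?_⟩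
  have h0 := ne_zero_of_notMem_rankOneSpan hy
  have h1 := finrank_quotient_span_singleton_add_one (K := K) h0
  have h3 := hV.finrank_orbitAt hy
  have h4 := finrank_orbitAt_add V y
  rw [hV.2, ← h1, choose_two_succ] at h4
  rw [finrank_quotEnd_stabAt hy]
  omega

theorem IsMaxTS.exists_smul_eq {f g : E →ₗ[K] K} (hf0 : f ≠ 0)
    (hf : ∀ M ∈ V, f (M y) = 0) (hg : ∀ M ∈ V, g (M y) = 0) : ∃ c : K, g = c • f := by
  refine exists_smul_eq_of_finrank_add_one (hV.finrank_orbitAt hy) hf0 ?_ ?_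
  · rintro _ ⟨M, hM, rfl⟩
    exact hf M hM
  · rintro _ ⟨M, hM, rfl⟩
    exact hg M hM

end Max

theorem IsTS.exists_form (hV : IsTS V) {y : E} (hy : y ≠ 0) :
    ∃ φ : E →ₗ[K] K, φ y = 1 ∧ ∀ M ∈ V, φ (M y) = 0 := by
  obtain ⟨φ, h1, h⟩ := exists_form_of_notMem (hV.notMem_orbitAt hy)
  exact ⟨φ, h1, fun M hM => h _ ⟨M, hM, rfl⟩⟩

theorem orbitAt_quotEnd {W : Submodule K (End K E)} (hG : ∀ M ∈ W, ∀ x ∈ G, M x ∈ G) (w : E) :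
    orbitAt (quotEnd G W) (G.mkQ w) = (orbitAt W w).map G.mkQ := by
  ext z
  constructor
  · rintro ⟨N, hN, rfl⟩
    obtain ⟨M, hM, h⟩ := mem_quotEnd.1 hN
    exact ⟨M w, ⟨M, hM, rfl⟩, h w⟩
  · rintro ⟨_, ⟨M, hM, rfl⟩, rfl⟩
    exact ⟨G.mapQ G M (hG M hM), mem_quotEnd.2 ⟨M, hM, fun _ => rfl⟩, rfl⟩

theorem IsMaxTS.orbitAt_stabAt [FiniteDimensional K E] (hV : IsMaxTS V) {y y' : E}
    (hy : y ∉ rankOneSpan V)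
    (hy' : (K ∙ y).mkQ y' ∉ rankOneSpan (quotEnd (K ∙ y) (stabAt V y))) :
    y ∉ orbitAt (stabAt V y) y' ∧
      finrank K (orbitAt (stabAt V y) y') + 2 = finrank K E := by
  have h0 := ne_zero_of_notMem_rankOneSpan hy
  have h1 := finrank_quotient_span_singleton_add_one (K := K) h0
  have h2 := (hV.quotEnd_stabAt hy).finrank_orbitAt hy'
  rw [orbitAt_quotEnd apply_mem_span_of_mem_stabAt] at h2
  have h3 := finrank_map_add_finrank_inf_ker (K ∙ y).mkQ (orbitAt (stabAt V y) y')
  rw [Submodule.ker_mkQ] at h3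
  have hnot : y ∉ orbitAt (stabAt V y) y' := by
    intro hmem
    rw [inf_eq_right.2 ((Submodule.span_singleton_le_iff_mem _ _).2 hmem),
      finrank_span_singleton h0] at h3
    have hne : ∀ t : K, y' + t • y ≠ 0 := fun t ht => by
      refine ne_zero_of_notMem_rankOneSpan hy' ?_
      rw [Submodule.mkQ_apply, Submodule.Quotient.mk_eq_zero, eq_neg_of_add_eq_zero_left ht]
      exact Submodule.neg_mem _ (Submodule.smul_mem _ _ (Submodule.mem_span_singleton_self y))
    obtain ⟨φ, hφ1, hφ⟩ := hV.1.exists_form (hne 0)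
    obtain ⟨ψ, hψ1, hψ⟩ := hV.1.exists_form (hne 1)
    simp only [zero_smul, add_zero, one_smul] at hφ1 hφ hψ1 hψ
    have hφ0 : φ ≠ 0 := fun h => by simp [h] at hφ1
    have hφW : ∀ w ∈ orbitAt (stabAt V y) y', φ w = 0 := by
      rintro _ ⟨M, hM, rfl⟩
      exact hφ M hM.1
    have hψW : ∀ w ∈ orbitAt (stabAt V y) y', ψ w = 0 := by
      rintro _ ⟨M, hM, rfl⟩
      have := hψ M hM.1
      rwa [map_add, show M y = 0 from hM.2, add_zero] at this
    obtain ⟨c, rfl⟩ := exists_smul_eq_of_finrank_add_one (by omega) hφ0 hφW hψW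
    have hc : c ≠ 0 := fun h => by simp [h] at hψ1
    obtain ⟨θ, hθ1, hθ⟩ := hV.1.exists_form h0
    obtain ⟨d, rfl⟩ := hV.exists_smul_eq hy (f := θ) (g := φ) (fun h => by simp [h] at hθ1) hθ
      (fun M hM => by
        have := hψ M hM
        rw [LinearMap.smul_apply, smul_eq_mul, map_add, map_add, hφ M hM, zero_add] at this
        exact (mul_eq_zero.1 this).resolve_left hc)
    have := hφW y hmem
    rw [LinearMap.smul_apply, hθ1, smul_eq_mul, mul_one] at this
    exact hφ0 (by rw [this, zero_smul])
  refine ⟨hnot, ?_⟩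
  have h4 : orbitAt (stabAt V y) y' ⊓ K ∙ y = ⊥ := by
    rw [eq_bot_iff]
    rintro z ⟨hz, hzy⟩
    obtain ⟨c, rfl⟩ := Submodule.mem_span_singleton.1 hzy
    by_cases hc : c = 0
    · simp [hc]
    · exact absurd ((Submodule.smul_mem_iff _ hc).1 hz) hnot
  rw [h4, finrank_bot] at h3
  omega

theorem IsMaxTS.finrank_orbitAt_stabAt_comm [FiniteDimensional K E] (hV : IsMaxTS V) {y y' : E}
    (hy : y ∉ rankOneSpan V) (hy' : y' ∉ rankOneSpan V) :
    finrank K (orbitAt (stabAt V y) y') = finrank K (orbitAt (stabAt V y') y) := by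
  have h1 := finrank_orbitAt_add V y
  have h2 := finrank_orbitAt_add V y'
  have h3 := finrank_orbitAt_add (stabAt V y) y'
  have h4 := finrank_orbitAt_add (stabAt V y') y
  have h5 := hV.finrank_orbitAt hy
  have h6 := hV.finrank_orbitAt hy'
  have h7 : stabAt (stabAt V y) y' = stabAt (stabAt V y') y := inf_right_comm _ _ _
  rw [h7] at h3
  omega

theorem comap_mkQ_ne_top {B : Submodule K (E ⧸ G)} (hB : B ≠ ⊤) : B.comap G.mkQ ≠ ⊤ := by
  obtain ⟨z, -, hz⟩ := SetLike.exists_of_lt (lt_top_iff_ne_top.2 hB)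
  obtain ⟨z, rfl⟩ := G.mkQ_surjective z
  intro h
  exact hz (Submodule.mem_comap.1 (h ▸ Submodule.mem_top))

theorem eq_smul_of_subsingleton_quotient {y : E} (h : ¬ Nontrivial (E ⧸ K ∙ y)) (w : E) :
    ∃ c : K, w = c • y := by
  rw [not_nontrivial_iff_subsingleton] at h
  have : w ∈ K ∙ y := (Submodule.Quotient.mk_eq_zero _).1 (Subsingleton.elim _ _)
  obtain ⟨c, hc⟩ := Submodule.mem_span_singleton.1 this
  exact ⟨c, hc.symm⟩

/-- In a maximal trivial-spectrum space, `M y = 0` forces the range of `M` into `V y`. -/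
theorem IsMaxTS.form_apply_eq_zero (hK : ∃ a : K, a ≠ 0 ∧ a ≠ 1) [FiniteDimensional K E]
    (hV : IsMaxTS V) {y : E} (hy : y ∉ rankOneSpan V) {φ : E →ₗ[K] K} (hφ1 : φ y = 1)
    (hφ : ∀ M ∈ V, φ (M y) = 0) {M : End K E} (hM : M ∈ V) (hMy : M y = 0) (w : E) :
    φ (M w) = 0 := by
  by_contra hw
  have hnt : Nontrivial (E ⧸ K ∙ y) := by
    by_contra h
    obtain ⟨c, rfl⟩ := eq_smul_of_subsingleton_quotient h w
    rw [map_smul, hMy, smul_zero, map_zero] at hw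
    exact hw rfl
  have hnt' : Nontrivial E := ⟨y, 0, ne_zero_of_notMem_rankOneSpan hy⟩
  obtain ⟨y', h1, h2, h3⟩ := exists_notMem_three hK hV.1.rankOneSpan_ne_top
    (comap_mkQ_ne_top (hV.1.quotEnd_stabAt y).rankOneSpan_ne_top)
    (ker_ne_top_of_apply_ne_zero (f := φ ∘ₗ M) hw)
  rw [Submodule.mem_comap] at h2
  suffices h : ∀ N ∈ V, N y = 0 → φ (N y') = 0 from h3 (h M hM hMy)
  have hW := (hV.orbitAt_stabAt hy h2).2
  rw [hV.finrank_orbitAt_stabAt_comm hy h1] at hW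
  have hne : ∀ t : K, y' + t • y ≠ 0 := fun t ht => by
    refine ne_zero_of_notMem_rankOneSpan h2 ?_
    rw [Submodule.mkQ_apply, Submodule.Quotient.mk_eq_zero, eq_neg_of_add_eq_zero_left ht]
    exact Submodule.neg_mem _ (Submodule.smul_mem _ _ (Submodule.mem_span_singleton_self y))
  obtain ⟨a, ha0, ha1⟩ := hK
  obtain ⟨f, hf1, hf⟩ := hV.1.exists_form (hne 1)
  obtain ⟨g, hg1, hg⟩ := hV.1.exists_form (hne a)
  have hf0 : f ≠ 0 := fun h => by simp [h] at hf1
  simp only [map_add, map_smul, smul_eq_mul, one_mul] at hf hg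
  have hfy : ∀ N ∈ V, N y = 0 → f (N y') = 0 := fun N hN h0 => by
    simpa [h0] using hf N hN
  have hgy : ∀ N ∈ V, N y = 0 → g (N y') = 0 := fun N hN h0 => by
    simpa [h0] using hg N hN
  by_cases hfg : ∃ c : K, g = c • f
  · obtain ⟨c, rfl⟩ := hfg
    have hc : c ≠ 0 := fun h => by simp [h] at hg1
    obtain ⟨d, rfl⟩ := hV.exists_smul_eq hy hf0 (fun N hN => by
      have e1 := hf N hN
      have e2 := hg N hN
      simp only [LinearMap.smul_apply, smul_eq_mul] at e2
      have e3 : c * (a - 1) * f (N y) = 0 := by linear_combination e2 - c * e1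
      simpa [hc, sub_ne_zero.2 ha1] using e3) hφ
    intro N hN h0
    rw [LinearMap.smul_apply, hfy N hN h0, smul_zero]
  · push Not at hfg
    obtain ⟨b, c, rfl⟩ := exists_add_smul_eq_of_finrank_add_two hW hf0 hfg (h := φ)
      (by
        rintro _ ⟨N, hN, rfl⟩
        simpa [show N y' = 0 from hN.2] using hf N hN.1)
      (by
        rintro _ ⟨N, hN, rfl⟩
        simpa [show N y' = 0 from hN.2, ha0] using hg N hN.1)
      (by
        rintro _ ⟨N, hN, rfl⟩
        exact hφ N hN.1)
    intro N hN h0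
    simp [hfy N hN h0, hgy N hN h0]

/-- A rank-one element not vanishing at `y` can be replaced by one with the same range and
the form cutting out `V y`. -/
theorem IsMaxTS.smulRight_mem (hK : ∃ a : K, a ≠ 0 ∧ a ≠ 1) [FiniteDimensional K E]
    (hV : IsMaxTS V) {y : E} (hy : y ∉ rankOneSpan V) {φ : E →ₗ[K] K} (hφ1 : φ y = 1)
    (hφ : ∀ M ∈ V, φ (M y) = 0) {x : E} {f : E →ₗ[K] K} (hf : f.smulRight x ∈ V)
    (hfy : f y ≠ 0) : φ.smulRight x ∈ V := by
  have h0 := ne_zero_of_notMem_rankOneSpan hy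
  have hφ0 : φ ≠ 0 := fun h => by simp [h] at hφ1
  obtain ⟨U, hU⟩ : ∃ U : Submodule K (End K E), ∀ M, M ∈ U ↔ M ∈ V ∧ ∀ w, φ (M w) = 0 :=
    ⟨V ⊓ LinearMap.ker (LinearMap.compRight K φ), fun M => by simp [LinearMap.ext_iff]⟩
  have hle : stabAt V y ≤ U := fun M hM => (hU M).2
    ⟨hM.1, fun w => hV.form_apply_eq_zero hK hy hφ1 hφ hM.1 hM.2 w⟩
  have hUY : ∀ M ∈ U, ∀ x ∈ LinearMap.ker φ, M x ∈ LinearMap.ker φ := fun M hM x _ =>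
    ((hU M).1 hM).2 x
  have h1 := finrank_quotient_span_singleton_add_one (K := K) h0
  have h2 := (hV.quotEnd_stabAt hy).2
  rw [finrank_quotEnd_stabAt hy] at h2
  have h3 := finrank_restrEnd (fun M hM => hUY M (hle hM))
  have h4 : stabAt V y ⊓
      LinearMap.ker (LinearMap.lcomp K E (LinearMap.ker φ).subtype) = ⊥ := by
    rw [eq_bot_iff]
    rintro M ⟨hM, hMY⟩
    rw [SetLike.mem_coe, mem_ker_lcomp_subtype] at hMY
    refine (Submodule.mem_bot K).2 (LinearMap.ext fun w => ?_)
    have := hMY (w - φ w • y) (by simp [hφ1])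
    rwa [map_sub, map_smul, show M y = 0 from hM.2, smul_zero, sub_zero] at this
  rw [h4, finrank_bot, add_zero] at h3
  have h5 := (hV.1.mono fun M hM => ((hU M).1 hM).1).isTS_restrEnd (G := LinearMap.ker φ) |>.finrank_le
  have h6 : finrank K (LinearMap.ker φ) = finrank K (E ⧸ K ∙ y) := by
    have := LinearMap.finrank_range_add_finrank_ker φ
    rw [LinearMap.range_eq_top.2 (LinearMap.surjective hφ0), finrank_top, finrank_self] at this
    omega
  rw [h6] at h5
  have h7 := Submodule.eq_of_le_of_finrank_le
    (restrEnd_mono (G := LinearMap.ker φ) hle) (by omega)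
  have hxφ : φ x = 0 := by
    have := hφ _ hf
    simpa [hfy] using this
  have hfU : f.smulRight x ∈ U := (hU _).2 ⟨hf, fun w => by simp [hxφ]⟩
  have h8 : (f.smulRight x).restrict (hUY _ hfU) ∈ restrEnd (LinearMap.ker φ) U :=
    mem_restrEnd.2 ⟨_, hfU, fun _ => rfl⟩
  rw [← h7] at h8
  obtain ⟨N, hN, hNf⟩ := mem_restrEnd.1 h8
  have h9 : φ.smulRight x = (f y)⁻¹ • (f.smulRight x - N) := LinearMap.ext fun w => by
    have e1 := hNf ⟨w - φ w • y, by simp [hφ1]⟩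
    have e2 : N w = f (w - φ w • y) • x := by
      simpa [show N y = 0 from hN.2] using e1
    rw [LinearMap.smul_apply, LinearMap.sub_apply, e2, LinearMap.smulRight_apply,
      LinearMap.smulRight_apply, ← sub_smul, smul_smul]
    congr 1
    rw [map_sub, map_smul, smul_eq_mul]
    field_simp
    ring
  rw [h9]
  exact V.smul_mem _ (V.sub_mem hf hN.1)

theorem IsMaxTS.form_apply_rankOneSpan (hK : ∃ a : K, a ≠ 0 ∧ a ≠ 1) [FiniteDimensional K E]
    (hV : IsMaxTS V) {y : E} (hy : y ∉ rankOneSpan V) {φ : E →ₗ[K] K} (hφ1 : φ y = 1)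
    (hφ : ∀ M ∈ V, φ (M y) = 0) {z : E} (hz : z ∈ rankOneSpan V) : φ z = 0 := by
  suffices h : rankOneSpan V ≤ LinearMap.ker φ from h hz
  rw [rankOneSpan, Submodule.span_le]
  rintro x ⟨f, hf0, hf⟩
  rw [SetLike.mem_coe, LinearMap.mem_ker]
  by_cases hfy : f y = 0
  · obtain ⟨w, hw⟩ : ∃ w, f w ≠ 0 := by
      by_contra! h
      exact hf0 (LinearMap.ext h)
    have := hV.form_apply_eq_zero hK hy hφ1 hφ hf (by simp [hfy]) w
    simpa [hw] using this
  · have := hφ _ hf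
    simpa [hfy] using this

end MaxTS

section Reduction

variable {K E : Type*} [Field K] [AddCommGroup E] [Module K E] [FiniteDimensional K E]
variable {V : Submodule K (End K E)} {G : Submodule K E}

theorem finrank_ker_inf_ker_le (G : Submodule K E) :
    finrank K (LinearMap.ker (LinearMap.lcomp K E G.subtype) ⊓
      LinearMap.ker (LinearMap.compRight K G.mkQ) : Submodule K (End K E)) ≤
      finrank K G * finrank K (E ⧸ G) := by
  have hle : LinearMap.ker (LinearMap.lcomp K E G.subtype) ⊓
      LinearMap.ker (LinearMap.compRight K G.mkQ) ≤
      LinearMap.range ((LinearMap.compRight K G.subtype) ∘ₗ (LinearMap.lcomp K G G.mkQ)) := by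
    rintro T ⟨h1, h2⟩
    rw [SetLike.mem_coe, mem_ker_lcomp_subtype] at h1
    rw [SetLike.mem_coe, mem_ker_compRight_mkQ] at h2
    refine ⟨G.liftQ (T.codRestrict G h2) fun x hx => ?_, LinearMap.ext fun x => rfl⟩
    exact Subtype.ext (h1 x hx)
  refine (Submodule.finrank_mono hle).trans ((LinearMap.finrank_range_le _).trans ?_)
  rw [finrank_linearMap, mul_comm]

theorem choose_two_add (a b : ℕ) :
    (a + b).choose 2 = a.choose 2 + b.choose 2 + a * b := by
  induction b with
  | zero => simp
  | succ b ih =>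
    rw [← Nat.add_assoc, choose_two_succ, choose_two_succ, ih]
    ring

/-- A maximal trivial-spectrum space leaving `G` invariant is determined by the spaces it
induces on `G` and on `E ⧸ G`, which are maximal too. -/
theorem IsMaxTS.reduction (hV : IsMaxTS V) (hG : ∀ M ∈ V, ∀ x ∈ G, M x ∈ G) :
    IsMaxTS (restrEnd G V) ∧ IsMaxTS (quotEnd G V) ∧
      ∀ T : End K E, (∃ N ∈ V, ∀ x ∈ G, T x = N x) → (∃ N ∈ V, ∀ x, T x - N x ∈ G) →
        T ∈ V := by
  set ρ : End K E →ₗ[K] _ := LinearMap.lcomp K E G.subtype with hρ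
  set π : End K E →ₗ[K] _ := LinearMap.compRight K G.mkQ with hπ
  obtain ⟨W, hW⟩ : ∃ W, W = (V.map ρ).comap ρ ⊓ (V.map π).comap π := ⟨_, rfl⟩
  have hVW : V ≤ W := hW ▸ le_inf (Submodule.le_comap_map _ _) (Submodule.le_comap_map _ _)
  have h1 := finrank_map_add_finrank_inf_ker ρ W
  have h2 := finrank_map_add_finrank_inf_ker π (W ⊓ LinearMap.ker ρ)
  have h3 : finrank K (W.map ρ) ≤ finrank K (restrEnd G V) := by
    rw [← finrank_map_restrEnd, map_restrEnd hG]
    refine Submodule.finrank_mono (Submodule.map_le_iff_le_comap.2 ?_)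
    exact hW ▸ inf_le_left
  have h4 : finrank K ((W ⊓ LinearMap.ker ρ).map π) ≤ finrank K (quotEnd G V) := by
    rw [← finrank_map_quotEnd, map_quotEnd hG]
    refine Submodule.finrank_mono (Submodule.map_le_iff_le_comap.2 (inf_le_left.trans ?_))
    exact hW ▸ inf_le_right
  have h5 : finrank K (W ⊓ LinearMap.ker ρ ⊓ LinearMap.ker π : Submodule K (End K E)) ≤
      finrank K G * finrank K (E ⧸ G) :=
    (Submodule.finrank_mono (inf_le_inf_right _ inf_le_right)).trans (finrank_ker_inf_ker_le G)
  have h6 : finrank K V ≤ finrank K W := Submodule.finrank_mono hVW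
  have h7 := (hV.1.isTS_restrEnd (G := G)).finrank_le
  have h8 := (hV.1.isTS_quotEnd hG).finrank_le
  have h9 := hV.2
  rw [← Submodule.finrank_quotient_add_finrank G, add_comm, choose_two_add] at h9
  refine ⟨⟨hV.1.isTS_restrEnd, by omega⟩, ⟨hV.1.isTS_quotEnd hG, by omega⟩, ?_⟩
  have h10 := Submodule.eq_of_le_of_finrank_le hVW (by omega)
  rintro T ⟨N, hN, hTN⟩ ⟨N', hN', hTN'⟩
  rw [h10, hW]
  refine ⟨⟨N, hN, LinearMap.ext fun x => (hTN x x.2).symm⟩, N', hN', LinearMap.ext fun x => ?_⟩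
  exact ((Submodule.Quotient.eq G).2 (hTN' x)).symm

/-- A rank-one element of the space induced on `E ⧸ K ∙ y` lifts to a rank-one element. -/
theorem IsMaxTS.smulRight_comp_mkQ_mem (hK : ∃ a : K, a ≠ 0 ∧ a ≠ 1)
    (hV : IsMaxTS V) {y : E} (hy : y ∉ rankOneSpan V) {φ : E →ₗ[K] K} (hφ1 : φ y = 1)
    (hφ : ∀ M ∈ V, φ (M y) = 0) {a : E} (ha : φ a = 0) {f : (E ⧸ K ∙ y) →ₗ[K] K}
    (hf : f.smulRight ((K ∙ y).mkQ a) ∈ quotEnd (K ∙ y) (stabAt V y)) :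
    (f ∘ₗ (K ∙ y).mkQ).smulRight a ∈ V := by
  obtain ⟨M, hM, h⟩ := mem_quotEnd.1 hf
  have : (f ∘ₗ (K ∙ y).mkQ).smulRight a = M := LinearMap.ext fun w => by
    have h1 := h w
    rw [LinearMap.smulRight_apply, ← map_smul] at h1
    obtain ⟨c, hc⟩ := Submodule.mem_span_singleton.1 ((Submodule.Quotient.eq _).1 h1)
    have h2 := congrArg φ hc
    rw [map_sub, hV.form_apply_eq_zero hK hy hφ1 hφ hM.1 hM.2, map_smul, map_smul, ha, hφ1,
      smul_zero, sub_zero, smul_eq_mul, mul_one] at h2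
    rw [h2, zero_smul, eq_comm, sub_eq_zero] at hc
    rw [hc]
    rfl
  rw [this]
  exact hM.1

end Reduction

section NoRankOne

variable {K E : Type*} [Field K] [AddCommGroup E] [Module K E] [FiniteDimensional K E]
variable {V : Submodule K (End K E)}

omit [FiniteDimensional K E] in
theorem notMem_rankOneSpan_of_eq_bot (hb : rankOneSpan V = ⊥) {x : E} (hx : x ≠ 0) :
    x ∉ rankOneSpan V := by
  rwa [hb, Submodule.mem_bot]

theorem IsMaxTS.form_apply_self_ne_zero (hV : IsMaxTS V) (hb : rankOneSpan V = ⊥)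
    {f : E →ₗ[K] K} (hf0 : f ≠ 0) {x : E} (hx : x ≠ 0) (hf : ∀ M ∈ V, f (M x) = 0) :
    f x ≠ 0 := by
  obtain ⟨φ, hφ1, hφ⟩ := hV.1.exists_form hx
  obtain ⟨c, rfl⟩ := hV.exists_smul_eq (notMem_rankOneSpan_of_eq_bot hb hx) (f := φ)
    (fun h => by simp [h] at hφ1) hφ hf
  rw [LinearMap.smul_apply, hφ1, smul_eq_mul, mul_one]
  rintro rfl
  exact hf0 (zero_smul _ _)

theorem IsMaxTS.eq_smul_of_common_form (hV : IsMaxTS V) (hb : rankOneSpan V = ⊥)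
    {f : E →ₗ[K] K} (hf0 : f ≠ 0) {x x' : E} (hx : x ≠ 0) (hf : ∀ M ∈ V, f (M x) = 0)
    (hf' : ∀ M ∈ V, f (M x') = 0) : ∃ c : K, x' = c • x := by
  have h1 := hV.form_apply_self_ne_zero hb hf0 hx hf
  refine ⟨f x' / f x, ?_⟩
  by_contra hne
  refine hV.form_apply_self_ne_zero hb hf0 (sub_ne_zero.2 hne) (fun M hM => ?_) ?_
  · simp [hf M hM, hf' M hM]
  · simp [h1]

theorem IsMaxTS.exists_antisymm (hK : ∃ a : K, a ≠ 0 ∧ a ≠ 1) (hV : IsMaxTS V)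
    (hb : rankOneSpan V = ⊥) {φ ψ : E →ₗ[K] K} (hφ0 : φ ≠ 0) (hψ0 : ψ ≠ 0) {x y : E}
    (hy : y ≠ 0) (hxy : ∀ c : K, x ≠ c • y)
    (hφ : ∀ M ∈ V, φ (M x) = 0) (hψ : ∀ M ∈ V, ψ (M y) = 0) :
    ∃ c : K, c ≠ 0 ∧ ∀ M ∈ V, ψ (M x) + c * φ (M y) = 0 := by
  have hx : x ≠ 0 := fun h => hxy 0 (by simp [h])
  have hy' := notMem_rankOneSpan_of_eq_bot hb hy
  obtain ⟨χ, hχ1, hχ⟩ := hV.1.exists_form hy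
  obtain ⟨d, rfl⟩ := hV.exists_smul_eq hy' (f := χ) (fun h => by simp [h] at hχ1) hχ hψ
  have hbar : (K ∙ y).mkQ x ∉ rankOneSpan (quotEnd (K ∙ y) (stabAt V y)) := by
    intro hmem
    have hbot : rankOneSpan (quotEnd (K ∙ y) (stabAt V y)) ≤ ⊥ := by
      rw [rankOneSpan, Submodule.span_le]
      rintro a ⟨f, hf0, hf⟩
      obtain ⟨a, rfl⟩ := (K ∙ y).mkQ_surjective a
      have ha : (K ∙ y).mkQ a = (K ∙ y).mkQ (a - χ a • y) := by
        rw [map_sub, map_smul, (K ∙ y).mkQ_apply y, (Submodule.Quotient.mk_eq_zero _).2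
          (Submodule.mem_span_singleton_self y), smul_zero, sub_zero]
      rw [ha] at hf ⊢
      have h1 := smulRight_mem_imp (fun h => hf0 (LinearMap.ext fun z => by
          obtain ⟨z, rfl⟩ := (K ∙ y).mkQ_surjective z
          exact LinearMap.congr_fun h z))
        (hV.smulRight_comp_mkQ_mem hK hy' hχ1 hχ (by simp [hχ1]) hf)
      rw [hb, Submodule.mem_bot] at h1
      rw [h1, map_zero]
      exact zero_mem _
    have h2 := hbot hmem
    rw [Submodule.mem_bot, Submodule.mkQ_apply, Submodule.Quotient.mk_eq_zero,
      Submodule.mem_span_singleton] at h2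
    obtain ⟨c, hc⟩ := h2
    exact hxy c hc.symm
  have hdim := (hV.orbitAt_stabAt hy' hbar).2
  have hxy0 : x + y ≠ 0 := fun h => hxy (-1) (by rw [neg_one_smul, eq_neg_of_add_eq_zero_left h])
  obtain ⟨θ, hθ1, hθ⟩ := hV.1.exists_form hxy0
  have hθ0 : θ ≠ 0 := fun h => by simp [h] at hθ1
  have hyx : ∀ c : K, y ≠ c • x := by
    rintro c rfl
    by_cases hc : c = 0
    · simp [hc] at hy
    · exact hxy c⁻¹ (by rw [smul_smul, inv_mul_cancel₀ hc, one_smul])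
  obtain ⟨a, b, rfl⟩ := exists_add_smul_eq_of_finrank_add_two hdim hφ0 (g := d • χ) (h := θ)
    (by
      intro c hc
      obtain ⟨e, he⟩ := hV.eq_smul_of_common_form hb hψ0 hy hψ (x' := x) (fun M hM => by
        rw [hc, LinearMap.smul_apply, hφ M hM, smul_zero])
      exact hxy e he)
    (by
      rintro _ ⟨M, hM, rfl⟩
      exact hφ M hM.1)
    (by
      rintro _ ⟨M, hM, rfl⟩
      change (d • χ) (M x) = 0
      rw [LinearMap.smul_apply, hV.form_apply_eq_zero hK hy' hχ1 hχ hM.1 hM.2, smul_zero])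
    (by
      rintro _ ⟨M, hM, rfl⟩
      have := hθ M hM.1
      rwa [map_add, show M y = 0 from hM.2, add_zero] at this)
  have hb0 : b ≠ 0 := by
    rintro rfl
    obtain ⟨e, he⟩ := hV.eq_smul_of_common_form hb hθ0 hx (x' := x + y) (fun M hM => by
      simp [hφ M hM]) hθ
    exact hyx (e - 1) (by rw [sub_smul, one_smul, ← he]; abel)
  have ha0 : a ≠ 0 := by
    rintro rfl
    obtain ⟨e, he⟩ := hV.eq_smul_of_common_form hb hθ0 hy (x' := x + y) (fun M hM => by
      simp [hχ M hM]) hθ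
    exact hxy (e - 1) (by rw [sub_smul, one_smul, ← he]; abel)
  refine ⟨a / b, div_ne_zero ha0 hb0, fun M hM => ?_⟩
  have e1 := hθ M hM
  have e2 := hφ M hM
  have e3 := hψ M hM
  simp only [LinearMap.add_apply, LinearMap.smul_apply, smul_eq_mul, map_add] at e1 e2 e3 ⊢
  field_simp
  linear_combination e1 - a * e2 - b * e3

theorem IsMaxTS.antisymm_of_antisymm (hK : ∃ a : K, a ≠ 0 ∧ a ≠ 1) (hV : IsMaxTS V)
    (hb : rankOneSpan V = ⊥) {φ ψ χ : E →ₗ[K] K} (hφ0 : φ ≠ 0) (hψ0 : ψ ≠ 0) (hχ0 : χ ≠ 0)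
    {x y z : E} (hxyz : ∀ a b c : K, a • x + b • y + c • z = 0 → a = 0 ∧ b = 0 ∧ c = 0)
    (hφ : ∀ M ∈ V, φ (M x) = 0) (hψ : ∀ M ∈ V, ψ (M y) = 0) (hχ : ∀ M ∈ V, χ (M z) = 0)
    (hφχ : ∀ M ∈ V, χ (M x) + φ (M z) = 0) (hψχ : ∀ M ∈ V, χ (M y) + ψ (M z) = 0) :
    ∀ M ∈ V, φ (M y) + ψ (M x) = 0 := by
  have hx : x ≠ 0 := fun h => one_ne_zero (hxyz 1 0 0 (by simp [h])).1
  have hy : y ≠ 0 := fun h => one_ne_zero (hxyz 0 1 0 (by simp [h])).2.1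
  have hz : z ≠ 0 := fun h => one_ne_zero (hxyz 0 0 1 (by simp [h])).2.2
  obtain ⟨c, hc0, hc⟩ := hV.exists_antisymm hK hb (φ := ψ) (ψ := φ) (x := y) (y := x) hψ0 hφ0 hx
    (fun c h => one_ne_zero (hxyz (-c) 1 0 (by rw [h]; module)).2.1) hψ hφ
  have hθ0 : φ + c • ψ ≠ 0 := by
    intro h
    have h1 : φ = -(c • ψ) := eq_neg_of_add_eq_zero_left h
    obtain ⟨e, he⟩ := hV.eq_smul_of_common_form hb hφ0 hx hφ (x' := y) (fun M hM => by
      simp [h1, hψ M hM])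
    exact one_ne_zero (hxyz (-e) 1 0 (by rw [he]; module)).2.1
  obtain ⟨k, hk0, hk⟩ := hV.exists_antisymm hK hb (φ := φ + c • ψ) (ψ := χ) (x := x + y) (y := z)
    hθ0 hχ0 hz (fun c h => one_ne_zero (hxyz 1 1 (-c) (by rw [one_smul, one_smul, h]; module)).1)
    (fun M hM => by
      have e1 := hφ M hM
      have e2 := hψ M hM
      have e3 := hc M hM
      simp only [LinearMap.add_apply, LinearMap.smul_apply, smul_eq_mul, map_add]
      linear_combination e3 + e1 + c * e2) hχ
  obtain ⟨e, he⟩ := hV.eq_smul_of_common_form hb hχ0 hz hχ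
    (x' := (k - 1) • x + (k * c - 1) • y) (fun M hM => by
      have e1 := hk M hM
      have e2 := hφχ M hM
      have e3 := hψχ M hM
      simp only [LinearMap.add_apply, LinearMap.smul_apply, smul_eq_mul, map_add, map_smul] at e1 ⊢
      linear_combination k * e2 + k * c * e3 - e1)
  obtain ⟨h1, h2, -⟩ := hxyz (k - 1) (k * c - 1) (-e) (by rw [he]; module)
  obtain rfl : k = 1 := sub_eq_zero.1 h1
  obtain rfl : c = 1 := by linear_combination h2
  intro M hM
  have := hc M hM
  rwa [one_mul] at this

/-- A maximal trivial-spectrum space without rank-one elements is adjoint-alternating for a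
non-isotropic bilinear form. -/
theorem IsMaxTS.exists_bilin_of_rankOneSpan_eq_bot (hK : ∃ a : K, a ≠ 0 ∧ a ≠ 1)
    [Nontrivial E] (hV : IsMaxTS V) (hb : rankOneSpan V = ⊥) :
    ∃ B : E →ₗ[K] E →ₗ[K] K, (∀ M ∈ V, ∀ w, B w (M w) = 0) ∧ ∀ w, w ≠ 0 → B w w ≠ 0 := by
  classical
  let e := finBasis K E
  have : Nonempty (Fin (finrank K E)) := e.index_nonempty
  obtain ⟨i₀⟩ := this
  obtain ⟨χ, hχ1, hχ⟩ := hV.1.exists_form (e.ne_zero i₀)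
  have hχ0 : χ ≠ 0 := fun h => by simp [h] at hχ1
  have hex : ∀ i, ∃ φ : E →ₗ[K] K, φ ≠ 0 ∧ (∀ M ∈ V, φ (M (e i)) = 0) ∧ (i = i₀ → φ = χ) ∧
      (i ≠ i₀ → ∀ M ∈ V, χ (M (e i)) + φ (M (e i₀)) = 0) := by
    intro i
    by_cases hi : i = i₀
    · subst hi
      exact ⟨χ, hχ0, hχ, fun _ => rfl, fun h => absurd rfl h⟩
    · obtain ⟨φ, hφ1, hφ⟩ := hV.1.exists_form (e.ne_zero i)
      have hφ0 : φ ≠ 0 := fun h => by simp [h] at hφ1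
      obtain ⟨c, hc0, hc⟩ := hV.exists_antisymm hK hb hφ0 hχ0 (e.ne_zero i₀) (x := e i)
        (fun c h => by
          have := congrArg (fun v => e.repr v i) h
          simp [Ne.symm hi] at this) hφ hχ
      exact ⟨c • φ, smul_ne_zero hc0 hφ0, fun M hM => by simp [hφ M hM],
        fun h => absurd h hi, fun _ M hM => by simpa using hc M hM⟩
  choose φ hφ0 hφ hφi hφχ using hex
  have hφφ : ∀ i j, ∀ M ∈ V, φ i (M (e j)) + φ j (M (e i)) = 0 := by
    intro i j M hM
    by_cases hij : i = j
    · subst hij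
      rw [hφ i M hM, add_zero]
    by_cases hi : i = i₀
    · subst hi
      rw [hφi i rfl]
      exact hφχ j (Ne.symm hij) M hM
    by_cases hj : j = i₀
    · subst hj
      rw [hφi j rfl, add_comm]
      exact hφχ i hij M hM
    refine hV.antisymm_of_antisymm hK hb (hφ0 i) (hφ0 j) hχ0 (z := e i₀) ?_ (hφ i) (hφ j) hχ
      (hφχ i hi) (hφχ j hj) M hM
    intro a b c habc
    refine ⟨?_, ?_, ?_⟩
    · simpa [Finsupp.single_apply, Ne.symm hi, hij, Ne.symm hij, hi, hj] using
        congrArg (fun v => e.repr v i) habc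
    · simpa [Finsupp.single_apply, Ne.symm hj, hij, Ne.symm hij, hi, hj] using
        congrArg (fun v => e.repr v j) habc
    · simpa [Finsupp.single_apply, Ne.symm hj, hij, Ne.symm hij, hi, hj] using
        congrArg (fun v => e.repr v i₀) habc
  let B : E →ₗ[K] E →ₗ[K] K := e.constr K φ
  have hBe : ∀ i, B (e i) = φ i := fun i => e.constr_basis K φ i
  have hanti : ∀ M ∈ V, ∀ w w', B w (M w') + B w' (M w) = 0 := by
    intro M hM w w'
    have h : B.compl₂ M + (B.compl₂ M).flip = 0 := e.ext fun i => e.ext fun j => by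
      simp only [LinearMap.add_apply, LinearMap.compl₂_apply, LinearMap.flip_apply,
        LinearMap.zero_apply, hBe]
      exact hφφ i j M hM
    exact LinearMap.congr_fun (LinearMap.congr_fun h w) w'
  have halt : ∀ M ∈ V, ∀ w, B w (M w) = 0 := by
    intro M hM w
    have hw : w ∈ Submodule.span K (Set.range e) := by
      rw [e.span_eq]
      exact Submodule.mem_top
    induction hw using Submodule.span_induction with
    | mem x hx =>
      obtain ⟨i, rfl⟩ := hx
      rw [hBe]
      exact hφ i M hM
    | zero => simp
    | add x y _ _ hx hy =>
      have := hanti M hM x y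
      simp only [map_add, LinearMap.add_apply]
      linear_combination this + hx + hy
    | smul c x _ hx => simp [hx]
  refine ⟨B, halt, fun w hw => ?_⟩
  refine hV.form_apply_self_ne_zero hb (fun h0 => ?_) hw fun M hM => halt M hM w
  obtain ⟨c, hc⟩ := hV.eq_smul_of_common_form hb (hφ0 i₀) hw (x' := e i₀) (fun M hM => by
    have := hanti M hM w (e i₀)
    rwa [h0, hBe, LinearMap.zero_apply, zero_add] at this) (hφ i₀)
  apply hφ0 i₀
  rw [← hBe, hc, map_smul, h0, smul_zero]

end NoRankOne

/-- `G` is a proper invariant subspace and `b` is a bilinear form with radical `G`,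
non-isotropic outside `G`, for which every element of `V` is adjoint-alternating. -/
structure IsTopForm {K E : Type*} [Field K] [AddCommGroup E] [Module K E]
    (V : Submodule K (End K E)) (G : Submodule K E) (b : E →ₗ[K] E →ₗ[K] K) : Prop where
  ne_top : G ≠ ⊤
  map_mem : ∀ M ∈ V, ∀ x ∈ G, M x ∈ G
  left : ∀ g ∈ G, ∀ w, b g w = 0
  right : ∀ w, ∀ g ∈ G, b w g = 0
  alt : ∀ M ∈ V, ∀ w, b w (M w) = 0
  aniso : ∀ w, w ∉ G → b w w ≠ 0

section TopForm

variable {K E : Type*} [Field K] [AddCommGroup E] [Module K E]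
variable {V : Submodule K (End K E)} {G : Submodule K E}

theorem IsTopForm.pullback {G' : Submodule K (E ⧸ G)} {b : (E ⧸ G) →ₗ[K] (E ⧸ G) →ₗ[K] K}
    (h : IsTopForm (quotEnd G V) G' b) (hG : ∀ M ∈ V, ∀ x ∈ G, M x ∈ G) :
    IsTopForm V (G'.comap G.mkQ) (b.compl₁₂ G.mkQ G.mkQ) := by
  have hM : ∀ M, ∀ hM : M ∈ V, G.mapQ G M (hG M hM) ∈ quotEnd G V := fun M hM =>
    mem_quotEnd.2 ⟨M, hM, fun _ => rfl⟩
  exact {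
    ne_top := comap_mkQ_ne_top h.ne_top
    map_mem := fun M hMV x hx => h.map_mem _ (hM M hMV) _ hx
    left := fun g hg w => h.left _ hg _
    right := fun w g hg => h.right _ _ hg
    alt := fun M hMV w => h.alt _ (hM M hMV) _
    aniso := fun w hw => h.aniso _ hw }

theorem IsTopForm.rankOneSpan_le {b : E →ₗ[K] E →ₗ[K] K} (h : IsTopForm V G b) :
    rankOneSpan V ≤ G := by
  rw [rankOneSpan, Submodule.span_le]
  rintro x ⟨f, hf0, hf⟩
  by_contra hx
  obtain ⟨w, hw1, hw2⟩ := exists_notMem_two (G₁ := LinearMap.ker f)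
    (fun h => hf0 (LinearMap.ker_eq_top.1 h))
    (ker_ne_top_of_apply_ne_zero (f := b.flip x) (x := x) (h.aniso x hx))
  have := h.alt _ hf w
  rw [LinearMap.smulRight_apply, map_smul, smul_eq_mul] at this
  exact (mul_eq_zero.1 this).elim hw1 hw2

section Step

variable [FiniteDimensional K E] (hK : ∃ a : K, a ≠ 0 ∧ a ≠ 1) (hV : IsMaxTS V) {y : E}
  (hy : y ∉ rankOneSpan V) {φ : E →ₗ[K] K} (hφ1 : φ y = 1) (hφ : ∀ M ∈ V, φ (M y) = 0)
include hK hV hy hφ1 hφ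

theorem IsTopForm.exists_apply_eq {L : Submodule K (E ⧸ K ∙ y)}
    {b : (E ⧸ K ∙ y) →ₗ[K] (E ⧸ K ∙ y) →ₗ[K] K}
    (hL : IsTopForm (quotEnd (K ∙ y) (stabAt V y)) L b) {w u : E}
    (hw : (K ∙ y).mkQ w ∉ L) (hu : φ u = 0) (hwu : b ((K ∙ y).mkQ w) ((K ∙ y).mkQ u) = 0) :
    ∃ N ∈ V, N y = 0 ∧ N w = u := by
  have hdim := (hV.orbitAt_stabAt hy (fun h => hw (hL.rankOneSpan_le h))).2
  have hp := hL.pullback apply_mem_span_of_mem_stabAt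
  set b' := b.compl₁₂ (K ∙ y).mkQ (K ∙ y).mkQ with hb'
  have hyL : (K ∙ y).mkQ y ∈ L := by
    rw [Submodule.mkQ_apply, (Submodule.Quotient.mk_eq_zero _).2
      (Submodule.mem_span_singleton_self y)]
    exact zero_mem _
  have hle : orbitAt (stabAt V y) w ≤ LinearMap.ker φ ⊓ LinearMap.ker (b' w) := by
    rintro _ ⟨M, hM, rfl⟩
    exact ⟨hV.form_apply_eq_zero hK hy hφ1 hφ hM.1 hM.2 w, hp.alt M hM w⟩
  have h1 := finrank_map_add_finrank_inf_ker (b' w) (LinearMap.ker φ)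
  have h2 : 0 < finrank K ((LinearMap.ker φ).map (b' w)) := by
    rw [finrank_pos_iff, Submodule.nontrivial_iff_ne_bot, Submodule.ne_bot_iff]
    refine ⟨b' w (w - φ w • y), ⟨w - φ w • y, by simp [hφ1], rfl⟩, ?_⟩
    rw [map_sub, map_smul, hp.right w y hyL, smul_zero, sub_zero]
    exact hp.aniso w hw
  have h3 := Submodule.finrank_lt (ker_ne_top_of_apply_ne_zero (f := φ) (x := y) (by simp [hφ1]))
  have heq := Submodule.eq_of_le_of_finrank_le hle (by omega)
  have hmem : u ∈ LinearMap.ker φ ⊓ LinearMap.ker (b' w) := ⟨hu, hwu⟩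
  rw [← heq] at hmem
  obtain ⟨N, hN, h⟩ := hmem
  exact ⟨N, hN.1, hN.2, h⟩

theorem IsTopForm.smulRight_mem_of_mem [Nontrivial E] {L : Submodule K (E ⧸ K ∙ y)}
    {b : (E ⧸ K ∙ y) →ₗ[K] (E ⧸ K ∙ y) →ₗ[K] K}
    (hL : IsTopForm (quotEnd (K ∙ y) (stabAt V y)) L b) {c : E}
    (hc : (K ∙ y).mkQ c ∈ L) (hφc : φ c = 0) : φ.smulRight c ∈ V := by
  obtain ⟨p, -, hp⟩ := SetLike.exists_of_lt (lt_top_iff_ne_top.2 hL.ne_top)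
  obtain ⟨g, hg1, hg⟩ := exists_form_of_notMem hp
  have hgV : (g ∘ₗ (K ∙ y).mkQ).smulRight c ∈ V :=
    hV.smulRight_comp_mkQ_mem hK hy hφ1 hφ hφc
      (((hV.quotEnd_stabAt hy).reduction hL.map_mem).2.2 _
        ⟨0, zero_mem _, fun x hx => by simp [hg x hx]⟩
        ⟨0, zero_mem _, fun x => by simpa using L.smul_mem (g x) hc⟩)
  have hyq : (K ∙ y).mkQ y = 0 := by simp
  obtain ⟨q, rfl⟩ := (K ∙ y).mkQ_surjective p
  obtain ⟨y', hy'1, hy'2⟩ := exists_notMem_two hV.1.rankOneSpan_ne_top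
    (ker_ne_top_of_apply_ne_zero (f := g ∘ₗ (K ∙ y).mkQ) (x := q) (by
      rw [LinearMap.comp_apply, hg1]
      exact one_ne_zero))
  have hgy' : g ((K ∙ y).mkQ y') ≠ 0 := hy'2
  have hy'L : (K ∙ y).mkQ y' ∉ L := fun h => hgy' (hg _ h)
  obtain ⟨t, ht0, ht⟩ := exists_ne_zero_add_smul_notMem hK y' hy
  have hgt : g ((K ∙ y).mkQ (y' + t • y)) ≠ 0 := by
    rwa [map_add, map_smul, hyq, smul_zero, add_zero]
  obtain ⟨φ₁, h11, h1⟩ := hV.1.exists_form (ne_zero_of_notMem_rankOneSpan hy'1)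
  obtain ⟨φ₂, h21, h2⟩ := hV.1.exists_form (ne_zero_of_notMem_rankOneSpan ht)
  have hm1 := hV.smulRight_mem hK hy'1 h11 h1 hgV hgy'
  have hm2 := hV.smulRight_mem hK ht h21 h2 hgV hgt
  have h20 : φ₂ ≠ 0 := fun h => by simp [h] at h21
  have h10 : φ₁ ≠ 0 := fun h => by simp [h] at h11
  by_cases hd : ∃ k : K, φ₂ = k • φ₁
  · obtain ⟨k, rfl⟩ := hd
    obtain ⟨d, rfl⟩ := hV.exists_smul_eq hy h20 (fun M hM => by
      have e1 := h1 M hM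
      have e2 := h2 M hM
      simp only [LinearMap.smul_apply, smul_eq_mul, map_add, map_smul] at e2 ⊢
      have e3 : t * (k * φ₁ (M y)) = 0 := by linear_combination e2 - k * e1
      exact (mul_eq_zero.1 e3).resolve_left ht0) hφ
    have : (d • k • φ₁).smulRight c = d • (k • φ₁).smulRight c := by
      ext; simp [smul_smul, mul_assoc]
    rw [this]
    exact V.smul_mem _ hm2
  · push Not at hd
    obtain ⟨a, e, rfl⟩ := exists_add_smul_eq_of_finrank_add_two
      (hV.orbitAt_stabAt hy (fun h => hy'L (hL.rankOneSpan_le h))).2 h10 hd (h := φ)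
      (by
        rintro _ ⟨M, hM, rfl⟩
        exact h1 M hM.1)
      (by
        rintro _ ⟨M, hM, rfl⟩
        have := h2 M hM.1
        rwa [map_add, map_smul, show M y = 0 from hM.2, smul_zero, add_zero] at this)
      (by
        rintro _ ⟨M, hM, rfl⟩
        exact hV.form_apply_eq_zero hK hy hφ1 hφ hM.1 hM.2 y')
    have : (a • φ₁ + e • φ₂).smulRight c = a • φ₁.smulRight c + e • φ₂.smulRight c := by
      ext; simp [smul_smul, add_smul]
    rw [this]
    exact V.add_mem (V.smul_mem _ hm1) (V.smul_mem _ hm2)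

theorem IsTopForm.mem_of_smulRight_mem {L : Submodule K (E ⧸ K ∙ y)}
    {b : (E ⧸ K ∙ y) →ₗ[K] (E ⧸ K ∙ y) →ₗ[K] K}
    (hL : IsTopForm (quotEnd (K ∙ y) (stabAt V y)) L b) {M : End K E} (hM : M ∈ V) {z : E}
    (hz : φ (M z) ≠ 0) {x : E} (hx : φ.smulRight x ∈ V) : (K ∙ y).mkQ x ∈ L := by
  have hp := hL.pullback apply_mem_span_of_mem_stabAt
  set b' := b.compl₁₂ (K ∙ y).mkQ (K ∙ y).mkQ with hb'
  have hyL : y ∈ L.comap (K ∙ y).mkQ := by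
    rw [Submodule.mem_comap, Submodule.mkQ_apply, (Submodule.Quotient.mk_eq_zero _).2
      (Submodule.mem_span_singleton_self y)]
    exact zero_mem _
  have hφx : φ x = 0 := by simpa [hφ1] using hφ _ hx
  by_contra hxL
  obtain ⟨w₀, hw₀L, hw₀M, hw₀x⟩ := exists_notMem_three hK hp.ne_top
    (ker_ne_top_of_apply_ne_zero (f := φ ∘ₗ M) hz)
    (ker_ne_top_of_apply_ne_zero (f := b'.flip x) (x := x) (hp.aniso x hxL))
  obtain ⟨w, hw⟩ : ∃ w, w = w₀ - φ w₀ • y := ⟨_, rfl⟩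
  have hwL : w ∉ L.comap (K ∙ y).mkQ := fun h => hw₀L (by
    have := Submodule.add_mem _ h (Submodule.smul_mem _ (φ w₀) hyL)
    rwa [hw, sub_add_cancel] at this)
  have hφw : φ w = 0 := by simp [hw, hφ1]
  have hwM : φ (M w) ≠ 0 := by
    rw [hw, map_sub, map_smul, map_sub, map_smul, hφ M hM, smul_zero, sub_zero]
    exact hw₀M
  have hwx : b' w x ≠ 0 := by
    rw [hw, map_sub, map_smul, LinearMap.sub_apply, LinearMap.smul_apply, hp.left y hyL,
      smul_zero, sub_zero]
    exact hw₀x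
  obtain ⟨M₁, hM₁⟩ : ∃ M₁, M₁ = (φ (M w))⁻¹ • M := ⟨_, rfl⟩
  have hM₁V : M₁ ∈ V := hM₁ ▸ V.smul_mem _ hM
  have hM₁w : φ (M₁ w) = 1 := by simp [hM₁, hwM]
  obtain ⟨u₀, hu₀⟩ : ∃ u₀, u₀ = y + w - M₁ y - M₁ w := ⟨_, rfl⟩
  obtain ⟨t, ht⟩ : ∃ t, t = b' w u₀ / b' w x := ⟨_, rfl⟩
  obtain ⟨N, hN, hNy, hNw⟩ := hL.exists_apply_eq hK hV hy hφ1 hφ (w := w) (u := u₀ - t • x) hwL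
    (by simp [hu₀, hφ1, hφw, hφ _ hM₁V, hM₁w, hφx])
    (by
      change b' w (u₀ - t • x) = 0
      rw [map_sub, map_smul, ht, smul_eq_mul, div_mul_cancel₀ _ hwx, sub_self])
  have h0 := hV.1 (M₁ + N + t • φ.smulRight x)
    (V.add_mem (V.add_mem hM₁V hN) (V.smul_mem _ hx)) (y + w) (by
      simp only [LinearMap.add_apply, LinearMap.smul_apply, LinearMap.smulRight_apply, map_add,
        hNy, hNw, hφ1, hφw, hu₀]
      module)
  apply hwL
  rw [eq_neg_of_add_eq_zero_right h0]
  exact Submodule.neg_mem _ hyL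

theorem IsTopForm.apply_mem_rankOneSpan [Nontrivial E] {L : Submodule K (E ⧸ K ∙ y)}
    {b : (E ⧸ K ∙ y) →ₗ[K] (E ⧸ K ∙ y) →ₗ[K] K}
    (hL : IsTopForm (quotEnd (K ∙ y) (stabAt V y)) L b) {M : End K E} (hM : M ∈ V) {z : E}
    (hz : z ∈ rankOneSpan V) : M z ≠ y := by
  intro hMz
  have hp := hL.pullback apply_mem_span_of_mem_stabAt
  set b' := b.compl₁₂ (K ∙ y).mkQ (K ∙ y).mkQ with hb'
  have hyL : y ∈ L.comap (K ∙ y).mkQ := by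
    rw [Submodule.mem_comap, Submodule.mkQ_apply, (Submodule.Quotient.mk_eq_zero _).2
      (Submodule.mem_span_singleton_self y)]
    exact zero_mem _
  have hφz : φ z = 0 := hV.form_apply_rankOneSpan hK hy hφ1 hφ hz
  have hle : rankOneSpan V ≤ L.comap (K ∙ y).mkQ := by
    rw [rankOneSpan, Submodule.span_le]
    rintro x ⟨f, hf0, hf⟩
    by_cases hfy : f y = 0
    · exact hp.rankOneSpan_le (smulRight_mem_imp hf0 ⟨hf, by simp [hfy]⟩)
    · exact hL.mem_of_smulRight_mem hK hV hy hφ1 hφ hM (z := z) (by simp [hMz, hφ1])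
        (hV.smulRight_mem hK hy hφ1 hφ hf hfy)
  have hzL := hle hz
  have hφc : φ (M y) = 0 := hφ M hM
  have hcL : M y ∈ L.comap (K ∙ y).mkQ := by
    by_contra hc
    obtain ⟨w₀, hw₀⟩ : ∃ w₀, w₀ = M y - φ (M (M y)) • z := ⟨_, rfl⟩
    have hw₀L : w₀ ∉ L.comap (K ∙ y).mkQ := fun h => hc (by
      have := Submodule.add_mem _ h (Submodule.smul_mem _ (φ (M (M y))) hzL)
      rwa [hw₀, sub_add_cancel] at this)
    have h1 : φ w₀ = 0 := by simp [hw₀, hφc, hφz]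
    have h2 : φ (M w₀) = 0 := by simp [hw₀, hMz, hφ1]
    have hβ := hp.aniso w₀ hw₀L
    have h3 : b' w₀ (M y) = b' w₀ w₀ := by
      have : M y = w₀ + φ (M (M y)) • z := by rw [hw₀, sub_add_cancel]
      rw [this, map_add, map_smul, hp.right _ z hzL, smul_zero, add_zero]
    obtain ⟨β, hβe⟩ : ∃ β, β = b' w₀ w₀ := ⟨_, rfl⟩
    obtain ⟨γ, hγe⟩ : ∃ γ, γ = b' w₀ (M w₀) := ⟨_, rfl⟩
    rw [← hβe] at hβ h3
    obtain ⟨s, hs0, hs⟩ : ∃ s : K, s ≠ 0 ∧ β - s * γ ≠ 0 := by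
      obtain ⟨a, ha0, ha1⟩ := hK
      by_contra! h
      have e1 := h 1 one_ne_zero
      have e2 := h a ha0
      have e3 : (a - 1) * γ = 0 := by linear_combination e1 - e2
      have e4 : γ = 0 := (mul_eq_zero.1 e3).resolve_left (sub_ne_zero.2 ha1)
      exact hβ (by simpa [e4] using e1)
    obtain ⟨t, ht⟩ : ∃ t, t = s * β / (β - s * γ) := ⟨_, rfl⟩
    have ht0 : t ≠ 0 := ht ▸ div_ne_zero (mul_ne_zero hs0 hβ) hs
    have ht' : t * (β - s * γ) = s * β := by rw [ht, div_mul_cancel₀ _ hs]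
    have hwL : t • w₀ + s⁻¹ • z ∉ L.comap (K ∙ y).mkQ := fun h => hw₀L (by
      have := Submodule.sub_mem _ h (Submodule.smul_mem _ s⁻¹ hzL)
      rw [add_sub_cancel_right] at this
      exact (Submodule.smul_mem_iff _ ht0).1 this)
    obtain ⟨N, hN, hNy, hNw⟩ := hL.exists_apply_eq hK hV hy hφ1 hφ (w := t • w₀ + s⁻¹ • z)
      (u := t • w₀ + s⁻¹ • z - s • M y - (s * t) • M w₀) hwL
      (by simp [h1, h2, hφz, hφc])
      (by
        change b' (t • w₀ + s⁻¹ • z) (t • w₀ + s⁻¹ • z - s • M y - (s * t) • M w₀) = 0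
        simp only [map_add, map_sub, map_smul, LinearMap.add_apply, LinearMap.smul_apply,
          hp.left z hzL, hp.right w₀ z hzL, h3, ← hβe, ← hγe, smul_eq_mul]
        linear_combination t * ht')
    have h0 := hV.1 (s • M + N) (V.add_mem (V.smul_mem _ hM) hN)
      (y + (t • w₀ + s⁻¹ • z)) (by
        rw [LinearMap.add_apply, map_add N, hNy, hNw]
        simp only [LinearMap.smul_apply, map_add, map_smul, hMz]
        rw [smul_smul s⁻¹ s, inv_mul_cancel₀ hs0]
        module)
    apply hwL
    rw [eq_neg_of_add_eq_zero_right h0]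
    exact Submodule.neg_mem _ hyL
  have hmem := hL.smulRight_mem_of_mem hK hV hy hφ1 hφ hcL hφc
  have := hV.form_apply_eq_zero hK hy hφ1 hφ (V.sub_mem hM hmem)
    (by simp [hφ1]) z
  rw [LinearMap.sub_apply, hMz, LinearMap.smulRight_apply, hφz, zero_smul, sub_zero, hφ1] at this
  exact one_ne_zero this

end Step

theorem IsMaxTS.exists_isTopForm_aux {K : Type*} [Field K] (hK : ∃ a : K, a ≠ 0 ∧ a ≠ 1) (n : ℕ) :
    ∀ (E : Type*) [AddCommGroup E] [Module K E] [FiniteDimensional K E] [Nontrivial E]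
      (V : Submodule K (End K E)), IsMaxTS V → finrank K E = n →
      ∃ (G : Submodule K E) (b : E →ₗ[K] E →ₗ[K] K), IsTopForm V G b := by
  induction n using Nat.strong_induction_on with
  | _ n ih =>
  intro E _ _ _ _ V hV hn
  by_cases hb : rankOneSpan V = ⊥
  · obtain ⟨B, h1, h2⟩ := hV.exists_bilin_of_rankOneSpan_eq_bot hK hb
    exact ⟨⊥, B, {
      ne_top := bot_ne_top
      map_mem := by simp
      left := by simp
      right := by simp
      alt := h1
      aniso := fun w hw => h2 w (by simpa using hw) }⟩
  have hinv : ∀ M ∈ V, ∀ x ∈ rankOneSpan V, M x ∈ rankOneSpan V := by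
    intro M hM z hz
    by_contra hy
    have h0 := ne_zero_of_notMem_rankOneSpan hy
    have hnt : Nontrivial (E ⧸ K ∙ M z) := by
      by_contra h
      obtain ⟨c, hc⟩ := eq_smul_of_subsingleton_quotient h z
      by_cases hc0 : c = 0
      · rw [hc0, zero_smul] at hc
        exact h0 (by rw [hc, map_zero])
      · rw [hc] at hz
        exact hy ((Submodule.smul_mem_iff _ hc0).1 hz)
    have h1 := finrank_quotient_span_singleton_add_one (K := K) h0
    obtain ⟨L, b, hL⟩ := ih _ (by omega) _ _ (hV.quotEnd_stabAt hy) rfl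
    obtain ⟨φ, hφ1, hφ⟩ := hV.1.exists_form h0
    exact hL.apply_mem_rankOneSpan hK hV hy hφ1 hφ hM hz rfl
  have hnt : Nontrivial (E ⧸ rankOneSpan V) :=
    Submodule.Quotient.nontrivial_iff.2 hV.1.rankOneSpan_ne_top
  have h1 := Submodule.finrank_quotient_add_finrank (rankOneSpan V)
  have h2 : 0 < finrank K (rankOneSpan V) := by
    rwa [finrank_pos_iff, Submodule.nontrivial_iff_ne_bot]
  obtain ⟨G', b, h⟩ := ih _ (by omega) _ _ (hV.reduction hinv).2.1 rfl
  exact ⟨_, _, h.pullback hinv⟩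

/-- A maximal trivial-spectrum space admits a non-zero invariant subspace on which it is
adjoint-alternating for a non-isotropic bilinear form. -/
theorem IsMaxTS.exists_bottomForm_aux {K : Type*} [Field K] (hK : ∃ a : K, a ≠ 0 ∧ a ≠ 1)
    (n : ℕ) : ∀ (E : Type*) [AddCommGroup E] [Module K E] [FiniteDimensional K E] [Nontrivial E]
      (V : Submodule K (End K E)), IsMaxTS V → finrank K E = n →
      ∃ (F : Submodule K E) (b : F →ₗ[K] F →ₗ[K] K), F ≠ ⊥ ∧ (∀ M ∈ V, ∀ x ∈ F, M x ∈ F) ∧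
        (∀ N ∈ restrEnd F V, ∀ w, b w (N w) = 0) ∧ ∀ w, w ≠ 0 → b w w ≠ 0 := by
  induction n using Nat.strong_induction_on with
  | _ n ih =>
  intro E _ _ _ _ V hV hn
  obtain ⟨G, b, h⟩ := IsMaxTS.exists_isTopForm_aux hK _ E V hV rfl
  by_cases hG : G = ⊥
  · subst hG
    refine ⟨⊤, b.compl₁₂ (Submodule.subtype ⊤) (Submodule.subtype ⊤), top_ne_bot, by simp,
      fun N hN w => ?_, fun w hw => h.aniso w (by simpa using hw)⟩
    obtain ⟨M, hM, hMN⟩ := mem_restrEnd.1 hN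
    have := h.alt M hM w
    rwa [hMN] at this
  have hnt : Nontrivial G := Submodule.nontrivial_iff_ne_bot.2 hG
  obtain ⟨F, c, hF0, hF, hc, hc'⟩ := ih (finrank K G)
    (hn ▸ Submodule.finrank_lt h.ne_top) G _ (hV.reduction h.map_mem).1 rfl
  have hFG : ∀ x ∈ F.map G.subtype, ∃ hx : x ∈ G, (⟨x, hx⟩ : G) ∈ F := by
    rintro _ ⟨x, hx, rfl⟩
    exact ⟨x.2, hx⟩
  have hinv : ∀ M ∈ V, ∀ x ∈ F.map G.subtype, M x ∈ F.map G.subtype := by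
    rintro M hM _ ⟨x, hx, rfl⟩
    exact ⟨_, hF (M.restrict (h.map_mem M hM)) (mem_restrEnd.2 ⟨M, hM, fun _ => rfl⟩) x hx, rfl⟩
  let e := (Submodule.equivMapOfInjective G.subtype G.injective_subtype F)
  refine ⟨F.map G.subtype, c.compl₁₂ e.symm.toLinearMap e.symm.toLinearMap, ?_, hinv, ?_, ?_⟩
  · intro h0
    exact hF0 (Submodule.map_injective_of_injective G.injective_subtype
      (h0.trans (Submodule.map_bot _).symm))
  · intro N hN w
    obtain ⟨M, hM, hMN⟩ := mem_restrEnd.1 hN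
    obtain ⟨w, rfl⟩ := e.surjective w
    have h1 := hc ((M.restrict (h.map_mem M hM)).restrict
      (hF _ (mem_restrEnd.2 ⟨M, hM, fun _ => rfl⟩)))
      (mem_restrEnd.2 ⟨M.restrict (h.map_mem M hM),
        mem_restrEnd.2 ⟨M, hM, fun _ => rfl⟩, fun _ => rfl⟩) w
    have h2 : e.symm (N (e w)) = (M.restrict (h.map_mem M hM)).restrict
        (hF _ (mem_restrEnd.2 ⟨M, hM, fun _ => rfl⟩)) w := by
      rw [LinearEquiv.symm_apply_eq]
      exact Subtype.ext (hMN (e w)).symm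
    simp only [LinearMap.compl₁₂_apply, LinearEquiv.coe_coe, LinearEquiv.symm_apply_apply, h2]
    exact h1
  · intro w hw
    exact hc' _ (by simpa using hw)

end TopForm

section Existence

variable {K E : Type*} [Field K] [AddCommGroup E] [Module K E]
theorem nonIsotropic.isUnit {k : ℕ} {P : Matrix (Fin k) (Fin k) K} (hP : nonIsotropic P) :
    IsUnit P := by
  rw [← Matrix.mulVec_injective_iff_isUnit]
  intro X Y hXY
  by_contra h
  refine hP (X - Y) (sub_ne_zero.2 h) ?_
  rw [mulVec_sub, show P.mulVec X = P.mulVec Y from hXY, sub_self, dotProduct_zero]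

theorem nonIsotropic.inv {k : ℕ} {P : Matrix (Fin k) (Fin k) K} (hP : nonIsotropic P) :
    nonIsotropic P⁻¹ := fun X hX h0 => by
  have hdet := (Matrix.isUnit_iff_isUnit_det P).1 hP.isUnit
  refine hP (P⁻¹.mulVec X) (fun h => hX ?_) ?_
  · rw [← one_mulVec X, ← mul_nonsing_inv P hdet, ← mulVec_mulVec, h, mulVec_zero]
  · rw [mulVec_mulVec, mul_nonsing_inv P hdet, one_mulVec, dotProduct_comm, h0]

variable {m n : Type*} [Fintype m] [DecidableEq m] [Fintype n] [DecidableEq n]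

theorem toMatrix_sumQuot {F : Submodule K E} (f : Basis m K F) (q : Basis n K (E ⧸ F))
    (M : End K E) (hM : ∀ x ∈ F, M x ∈ F) :
    ∃ B, LinearMap.toMatrix (f.sumQuot q) (f.sumQuot q) M =
      fromBlocks (LinearMap.toMatrix f f (M.restrict hM)) B 0
        (LinearMap.toMatrix q q (F.mapQ F M hM)) := by
  refine ⟨Matrix.of fun i j => (f.sumQuot q).repr (M (f.sumQuot q (Sum.inr j))) (Sum.inl i), ?_⟩
  ext (i | i) (j | j)
  · rw [LinearMap.toMatrix_apply, Basis.sumQuot_inl,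
      Basis.sumQuot_repr_inl_of_mem f q _ (hM _ (f j).2), fromBlocks_apply₁₁,
      LinearMap.toMatrix_apply]
    rfl
  · rw [LinearMap.toMatrix_apply]
    rfl
  · rw [LinearMap.toMatrix_apply, Basis.sumQuot_inl,
      Basis.sumQuot_repr_inr_of_mem f q _ (hM _ (f j).2)]
    rfl
  · rw [LinearMap.toMatrix_apply, Basis.sumQuot_repr_inr, fromBlocks_apply₂₂,
      LinearMap.toMatrix_apply, ← Basis.sumQuot_inr f q j]
    rfl

theorem map_mem_of_toMatrix_sumQuot {F : Submodule K E} (f : Basis m K F) (q : Basis n K (E ⧸ F))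
    {M : End K E} {A : Matrix m m K} {B : Matrix m n K} {C : Matrix n n K}
    (h : LinearMap.toMatrix (f.sumQuot q) (f.sumQuot q) M = fromBlocks A B 0 C) :
    ∀ x ∈ F, M x ∈ F := by
  have h1 : F.mkQ ∘ₗ M ∘ₗ F.subtype = 0 := f.ext fun j => q.ext_elem fun i => by
    have h2 := congrFun (congrFun h (Sum.inr i)) (Sum.inl j)
    rw [LinearMap.toMatrix_apply, Basis.sumQuot_inl, Basis.sumQuot_repr_inr,
      fromBlocks_apply₂₁] at h2
    simpa using h2
  intro x hx
  exact (Submodule.Quotient.mk_eq_zero F).1 (LinearMap.congr_fun h1 ⟨x, hx⟩)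

theorem toMatrix_basis_reindex (c : Basis m K E) (e : m ≃ n) (M : End K E) :
    LinearMap.toMatrix (c.reindex e) (c.reindex e) M = reindex e e (LinearMap.toMatrix c c M) := by
  ext i j
  simp [LinearMap.toMatrix_apply]

theorem IsMaxTS.mem_iff_of_invariant [FiniteDimensional K E] {V : Submodule K (End K E)}
    (hV : IsMaxTS V) {F : Submodule K E} (hF : ∀ M ∈ V, ∀ x ∈ F, M x ∈ F) {M : End K E} :
    M ∈ V ↔ ∃ hM : ∀ x ∈ F, M x ∈ F, M.restrict hM ∈ restrEnd F V ∧
      F.mapQ F M hM ∈ quotEnd F V := by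
  constructor
  · intro hM
    exact ⟨hF M hM, mem_restrEnd.2 ⟨M, hM, fun _ => rfl⟩, mem_quotEnd.2 ⟨M, hM, fun _ => rfl⟩⟩
  · rintro ⟨hM, h1, h2⟩
    obtain ⟨N, hN, h⟩ := mem_restrEnd.1 h1
    obtain ⟨N', hN', h'⟩ := mem_quotEnd.1 h2
    exact (hV.reduction hF).2.2 M ⟨N, hN, fun x hx => (h ⟨x, hx⟩).symm⟩
      ⟨N', hN', fun x => (Submodule.Quotient.eq F).1 (h' x).symm⟩

/-- A maximal trivial-spectrum space that is adjoint-alternating for a non-isotropic form is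
represented by `P • Alt`, with `P` the inverse of a Gram matrix. -/
theorem IsMaxTS.exists_matrix_of_bilin [FiniteDimensional K E] {V : Submodule K (End K E)}
    (hV : IsMaxTS V) {b : E →ₗ[K] E →ₗ[K] K} (hb : ∀ N ∈ V, ∀ w, b w (N w) = 0)
    (hb' : ∀ w, w ≠ 0 → b w w ≠ 0) {k : ℕ} (f : Basis (Fin k) K E) :
    ∃ P : Matrix (Fin k) (Fin k) K, IsUnit P ∧ nonIsotropic P ∧
      ∀ N, N ∈ V ↔ LinearMap.toMatrix f f N ∈ (fun A => P * A) '' altSet K k := by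
  have hV' : ∀ N, N ∈ V ↔ ∀ w, b w (N w) = 0 := by
    let S : Submodule K (End K E) :=
      { carrier := {N | ∀ w, b w (N w) = 0}
        add_mem' := fun {M N} hM hN w => by
          rw [LinearMap.add_apply, map_add, hM w, hN w, add_zero]
        zero_mem' := fun w => by simp
        smul_mem' := fun c N hN w => by
          rw [LinearMap.smul_apply, map_smul, hN w, smul_zero] }
    have hle : V ≤ S := hb
    have hS : IsTS S := fun N hN w hw => by
      by_contra h0
      have := hN w
      rw [hw] at this
      exact hb' w h0 this
    have heq := Submodule.eq_of_le_of_finrank_le hle (by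
      rw [hV.2]
      exact hS.finrank_le)
    intro N
    rw [heq]
    rfl
  obtain ⟨B, hB⟩ : ∃ B, B = LinearMap.toMatrix₂ f f b := ⟨_, rfl⟩
  have hBb : ∀ x y, b x y = f.repr x ⬝ᵥ B.mulVec (f.repr y) := fun x y => by
    rw [hB]
    exact apply_eq_dotProduct_toMatrix₂_mulVec f f b x y
  have hfX : ∀ X : Fin k → K, ⇑(f.repr (f.equivFun.symm X)) = X := f.equivFun.apply_symm_apply
  have hBX : nonIsotropic B := fun X hX => by
    have := hb' (f.equivFun.symm X) (f.equivFun.symm.map_ne_zero_iff.2 hX)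
    rwa [hBb, hfX] at this
  have hdet := (Matrix.isUnit_iff_isUnit_det B).1 hBX.isUnit
  refine ⟨B⁻¹, hBX.inv.isUnit, hBX.inv, ?_⟩
  intro N
  have h1 : ∀ w, b w (N w) = f.repr w ⬝ᵥ (B * LinearMap.toMatrix f f N).mulVec (f.repr w) :=
    fun w => by rw [hBb, ← mulVec_mulVec, LinearMap.toMatrix_mulVec_repr]
  rw [hV']
  constructor
  · intro h
    refine ⟨B * LinearMap.toMatrix f f N, fun X => ?_, ?_⟩
    · have := h (f.equivFun.symm X)
      rwa [h1, hfX] at this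
    · simp only
      rw [← Matrix.mul_assoc, nonsing_inv_mul B hdet, Matrix.one_mul]
  · rintro ⟨A, hA, h⟩ w
    simp only at h
    rw [h1, ← h, ← Matrix.mul_assoc, mul_nonsing_inv B hdet, Matrix.one_mul]
    exact hA _

theorem IsMaxTS.exists_bdSet_aux {K : Type*} [Field K] (hK : ∃ a : K, a ≠ 0 ∧ a ≠ 1) (n : ℕ) :
    ∀ (E : Type*) [AddCommGroup E] [Module K E] [FiniteDimensional K E]
      (V : Submodule K (End K E)), IsMaxTS V → finrank K E = n →
      ∃ l : List (Σ m : ℕ, Matrix (Fin m) (Fin m) K),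
        (∀ x ∈ l, 0 < x.1 ∧ IsUnit x.2 ∧ nonIsotropic x.2) ∧
        ∃ c : Basis (Fin (sigSum l)) K E, ∀ M, M ∈ V ↔ LinearMap.toMatrix c c M ∈ bdSet l := by
  induction n using Nat.strong_induction_on with
  | _ n ih =>
  intro E _ _ _ V hV hn
  rcases subsingleton_or_nontrivial E with hE | hE
  · refine ⟨[], by simp, finBasisOfFinrankEq K E (finrank_zero_of_subsingleton), fun M => ?_⟩
    have : M = 0 := Subsingleton.elim _ _
    simp [this, bdSet]
  obtain ⟨F, b, hF0, hF, hb, hb'⟩ := hV.exists_bottomForm_aux hK _ E V rfl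
  have hred := hV.reduction hF
  have h1 := Submodule.finrank_quotient_add_finrank F
  have h2 : 0 < finrank K F := by
    rwa [finrank_pos_iff, Submodule.nontrivial_iff_ne_bot]
  obtain ⟨l, hl, q, hq⟩ := ih _ (by omega) _ _ hred.2.1 rfl
  let f := finBasis K F
  obtain ⟨P, hP, hP', hPV⟩ := hred.1.exists_matrix_of_bilin hb hb' f
  refine ⟨⟨finrank K F, P⟩ :: l, ?_, (f.sumQuot q).reindex finSumFinEquiv, fun M => ?_⟩
  · rintro x (_ | ⟨_, hx⟩)
    · exact ⟨h2, hP, hP'⟩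
    · exact hl x hx
  · have hc := toMatrix_basis_reindex (f.sumQuot q) finSumFinEquiv M
    refine (hV.mem_iff_of_invariant hF).trans ((?_ : _ ↔ reindex finSumFinEquiv finSumFinEquiv _ ∈
      blockJoin ((fun A => P * A) '' altSet K _) (bdSet l)).trans
        (Iff.of_eq (congrArg (· ∈ blockJoin _ (bdSet l)) hc.symm)))
    constructor
    · rintro ⟨hM, h3, h4⟩
      obtain ⟨B, hB⟩ := toMatrix_sumQuot f q M hM
      exact ⟨_, (hPV _).1 h3, _, (hq _).1 h4, B, by rw [hB]⟩
    · rintro ⟨A, hA, C, hC, B, hB⟩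
      have hB' := (reindex finSumFinEquiv finSumFinEquiv).injective hB
      have hM := map_mem_of_toMatrix_sumQuot f q hB'
      obtain ⟨B', hB''⟩ := toMatrix_sumQuot f q M hM
      rw [hB'', fromBlocks_inj] at hB'
      exact ⟨hM, (hPV _).2 (hB'.1 ▸ hA), (hq _).2 (hB'.2.2.2 ▸ hC)⟩

theorem exists_represents (hK : ∃ a : K, a ≠ 0 ∧ a ≠ 1) {n : ℕ}
    (V : Submodule K (Matrix (Fin n) (Fin n) K))
    (htriv : TrivialSpectrum (V : Set (Matrix (Fin n) (Fin n) K)))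
    (hdim : finrank K V = n * (n - 1) / 2) :
    ∃ l : List (Σ m : ℕ, Matrix (Fin m) (Fin m) K), Represents V l := by
  have hmem : ∀ M, M ∈ V.map (Matrix.toLin' : Matrix (Fin n) (Fin n) K ≃ₗ[K] _).toLinearMap ↔
      LinearMap.toMatrix' M ∈ V := fun M => by
    constructor
    · rintro ⟨N, hN, rfl⟩
      simpa using hN
    · intro h
      exact ⟨_, h, by simp⟩
  have hV : IsMaxTS (V.map (Matrix.toLin' : Matrix (Fin n) (Fin n) K ≃ₗ[K] _).toLinearMap) := by
    constructor
    · rintro _ ⟨M, hM, rfl⟩ x hx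
      exact htriv M hM x hx
    · rw [LinearEquiv.finrank_map_eq, hdim, finrank_fin_fun, Nat.choose_two_right]
  obtain ⟨l, hl, c, hc⟩ := hV.exists_bdSet_aux hK _ _ _ rfl
  have h : sigSum l = n := by
    simpa using (finrank_eq_card_basis c).symm
  refine ⟨l, hl, h, ?_⟩
  let s := Pi.basisFun K (Fin n)
  let d := c.reindex (finCongr h)
  have hsd : s.toMatrix d * d.toMatrix s = 1 := s.toMatrix_mul_toMatrix_flip d
  have hds : d.toMatrix s * s.toMatrix d = 1 := d.toMatrix_mul_toMatrix_flip s
  have hinv : (s.toMatrix d)⁻¹ = d.toMatrix s := inv_eq_right_inv hsd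
  refine ⟨s.toMatrix d, IsUnit.of_mul_eq_one _ hsd, ?_⟩
  have key : ∀ M : Matrix (Fin n) (Fin n) K,
      M ∈ V ↔ d.toMatrix s * M * s.toMatrix d ∈ (reindex (finCongr h) (finCongr h)) '' bdSet l := by
    intro M
    have h1 : d.toMatrix s * M * s.toMatrix d = LinearMap.toMatrix d d (toLin' M) := by
      have h2 : LinearMap.toMatrix s s (toLin' M) = M := by
        rw [LinearMap.toMatrix_eq_toMatrix', LinearMap.toMatrix'_toLin']
      rw [← basis_toMatrix_mul_linearMap_toMatrix_mul_basis_toMatrix d s d s, h2]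
    rw [h1, toMatrix_basis_reindex, (reindex (finCongr h) (finCongr h)).injective.mem_set_image,
      ← hc, hmem, LinearMap.toMatrix'_toLin']
  ext M
  rw [SetLike.mem_coe, key, hinv]
  constructor
  · intro hM
    refine ⟨_, hM, ?_⟩
    simp only [← Matrix.mul_assoc, hsd, Matrix.one_mul]
    rw [Matrix.mul_assoc, hsd, Matrix.mul_one]
  · rintro ⟨N, hN, rfl⟩
    simp only [← Matrix.mul_assoc, hds, Matrix.one_mul]
    rwa [Matrix.mul_assoc, hds, Matrix.mul_one]

end Existence

section Uniqueness

variable {K : Type*} [Field K]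

/-- Two sets of square matrices, possibly of different index types, that correspond to each other
under a change of basis. -/
def ChangeOfBasis {m n : Type*} [Fintype m] [DecidableEq m] [Fintype n] [DecidableEq n]
    (S : Set (Matrix m m K)) (T : Set (Matrix n n K)) : Prop :=
  ∃ (Q : Matrix n m K) (Q' : Matrix m n K), Q * Q' = 1 ∧ Q' * Q = 1 ∧
    ∀ M, M ∈ S ↔ Q * M * Q' ∈ T

/-- The block matrices `[[A, B], [0, C]]` with `A ∈ S` and `C ∈ T`, indexed by a sum type. -/
def blockUpper {m n : Type*} (S : Set (Matrix m m K)) (T : Set (Matrix n n K)) :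
    Set (Matrix (m ⊕ n) (m ⊕ n) K) :=
  {M | ∃ A ∈ S, ∃ C ∈ T, ∃ B, M = fromBlocks A B 0 C}

theorem mem_blockUpper {m n : Type*} {S : Set (Matrix m m K)} {T : Set (Matrix n n K)}
    {A : Matrix m m K} {B : Matrix m n K} {C : Matrix n n K} :
    fromBlocks A B 0 C ∈ blockUpper S T ↔ A ∈ S ∧ C ∈ T := by
  constructor
  · rintro ⟨A', hA, C', hC, B', h⟩
    rw [fromBlocks_inj] at h
    exact ⟨h.1 ▸ hA, h.2.2.2 ▸ hC⟩
  · rintro ⟨hA, hC⟩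
    exact ⟨A, hA, C, hC, B, rfl⟩

theorem reindex_mem_blockJoin {a b : ℕ} {S : Set (Matrix (Fin a) (Fin a) K)}
    {T : Set (Matrix (Fin b) (Fin b) K)} {M : Matrix (Fin a ⊕ Fin b) (Fin a ⊕ Fin b) K} :
    reindex finSumFinEquiv finSumFinEquiv M ∈ blockJoin S T ↔ M ∈ blockUpper S T := by
  constructor
  · rintro ⟨A, hA, C, hC, B, h⟩
    exact ⟨A, hA, C, hC, B, (reindex finSumFinEquiv finSumFinEquiv).injective h⟩
  · rintro ⟨A, hA, C, hC, B, rfl⟩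
    exact ⟨A, hA, C, hC, B, rfl⟩

namespace ChangeOfBasis

variable {m n p q : Type*} [Fintype m] [DecidableEq m] [Fintype n] [DecidableEq n]
  [Fintype p] [DecidableEq p] [Fintype q] [DecidableEq q]
  {S : Set (Matrix m m K)} {T : Set (Matrix n n K)} {U : Set (Matrix p p K)}
  {W : Set (Matrix q q K)}

theorem symm (h : ChangeOfBasis S T) : ChangeOfBasis T S := by
  obtain ⟨Q, Q', h1, h2, h⟩ := h
  refine ⟨Q', Q, h2, h1, fun M => ?_⟩
  rw [h]
  simp only [← Matrix.mul_assoc, h1, Matrix.one_mul]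
  rw [Matrix.mul_assoc, h1, Matrix.mul_one]

theorem trans (h : ChangeOfBasis S T) (h' : ChangeOfBasis T U) : ChangeOfBasis S U := by
  obtain ⟨Q, Q', h1, h2, h⟩ := h
  obtain ⟨R, R', h3, h4, h'⟩ := h'
  refine ⟨R * Q, Q' * R', ?_, ?_, fun M => ?_⟩
  · rw [Matrix.mul_assoc, ← Matrix.mul_assoc Q, h1, Matrix.one_mul, h3]
  · rw [Matrix.mul_assoc, ← Matrix.mul_assoc R', h4, Matrix.one_mul, h2]
  · rw [h, h']
    simp only [Matrix.mul_assoc]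

theorem size_eq {a b : ℕ} {S : Set (Matrix (Fin a) (Fin a) K)} {T : Set (Matrix (Fin b) (Fin b) K)}
    (h : ChangeOfBasis S T) : a = b := by
  obtain ⟨Q, Q', h1, h2, -⟩ := h
  simpa using Matrix.square_of_invertible Q' Q h2 h1

theorem blockUpper (h : ChangeOfBasis S T) (h' : ChangeOfBasis U W) :
    ChangeOfBasis (blockUpper S U) (blockUpper T W) := by
  obtain ⟨Q, Q', h1, h2, h⟩ := h
  obtain ⟨R, R', h3, h4, h'⟩ := h'
  refine ⟨fromBlocks Q 0 0 R, fromBlocks Q' 0 0 R', ?_, ?_, fun M => ?_⟩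
  · simp [fromBlocks_multiply, h1, h3]
  · simp [fromBlocks_multiply, h2, h4]
  · constructor
    · rintro ⟨A, hA, C, hC, B, rfl⟩
      exact ⟨_, (h _).1 hA, _, (h' _).1 hC, Q * B * R', by simp [fromBlocks_multiply]⟩
    · rintro ⟨A, hA, C, hC, B, hM⟩
      rw [← fromBlocks_toBlocks M] at hM ⊢
      simp only [fromBlocks_multiply, Matrix.zero_mul, Matrix.mul_zero, add_zero, zero_add,
        fromBlocks_inj] at hM
      obtain ⟨h5, -, h7, h8⟩ := hM
      have h9 : M.toBlocks₂₁ = 0 := by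
        have := congrArg (fun N => R' * N * Q) h7
        simpa only [← Matrix.mul_assoc, h4, Matrix.one_mul, Matrix.mul_assoc _ Q' Q, h2,
          Matrix.mul_one, Matrix.mul_zero, Matrix.zero_mul] using this
      rw [h9, mem_blockUpper, h, h', h5, h8]
      exact ⟨hA, hC⟩

theorem reindex_finSumFinEquiv {a b : ℕ} (S : Set (Matrix (Fin a) (Fin a) K))
    (T : Set (Matrix (Fin b) (Fin b) K)) :
    ChangeOfBasis (_root_.blockUpper S T) (blockJoin S T) := by
  let e : Fin a ⊕ Fin b ≃ Fin (a + b) := finSumFinEquiv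
  refine ⟨(1 : Matrix _ _ K).submatrix e.symm id, (1 : Matrix _ _ K).submatrix id e.symm,
    ?_, ?_, fun M => ?_⟩
  · rw [← submatrix_mul _ _ e.symm id e.symm Function.bijective_id, Matrix.one_mul,
      submatrix_one_equiv]
  · rw [← submatrix_mul _ _ id e.symm id e.symm.bijective, Matrix.one_mul, submatrix_id_id]
  · have h : reindex e e M =
        (1 : Matrix (Fin a ⊕ Fin b) (Fin a ⊕ Fin b) K).submatrix e.symm id * M *
          (1 : Matrix (Fin a ⊕ Fin b) (Fin a ⊕ Fin b) K).submatrix id e.symm :=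
      calc
        reindex e e M = ((1 : Matrix _ _ K) * M * (1 : Matrix _ _ K)).submatrix e.symm e.symm := by
          rw [Matrix.one_mul, Matrix.mul_one, reindex_apply]
        _ = _ := by
          rw [submatrix_mul _ _ e.symm id e.symm Function.bijective_id,
            submatrix_mul _ _ e.symm id id Function.bijective_id, submatrix_id_id]
    rw [← h, reindex_mem_blockJoin]

end ChangeOfBasis

variable {m n : Type*} [Fintype m] [DecidableEq m] [Fintype n] [DecidableEq n]

theorem zero_mem_mul_altSet {k : ℕ} (P : Matrix (Fin k) (Fin k) K) :
    0 ∈ (fun A => P * A) '' altSet K k :=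
  ⟨0, fun X => by simp, by simp⟩

theorem zero_mem_bdSet : ∀ l : List (Σ m : ℕ, Matrix (Fin m) (Fin m) K), 0 ∈ bdSet l
  | [] => trivial
  | x :: xs => ⟨0, zero_mem_mul_altSet _, 0, zero_mem_bdSet xs, 0, by rw [fromBlocks_zero]; rfl⟩

theorem vecMulVec_sub_mem_altSet {k : ℕ} (x y : Fin k → K) :
    vecMulVec x y - vecMulVec y x ∈ altSet K k := fun X => by
  rw [sub_mulVec, vecMulVec_mulVec, vecMulVec_mulVec, dotProduct_sub]
  simp [dotProduct_comm, mul_comm]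

theorem exists_mem_altSet_mulVec_eq {k : ℕ} {x y : Fin k → K} (hx : x ≠ 0) (h : x ⬝ᵥ y = 0) :
    ∃ A ∈ altSet K k, A.mulVec x = y := by
  obtain ⟨i, hi⟩ := Function.ne_iff.1 hx
  refine ⟨_, vecMulVec_sub_mem_altSet y (Pi.single i (x i)⁻¹), ?_⟩
  have hi' : x i ≠ 0 := hi
  rw [sub_mulVec, vecMulVec_mulVec, vecMulVec_mulVec, dotProduct_comm y x, h]
  simp [hi']

theorem nonIsotropic.exists_mulVec_add_smul_eq {k : ℕ} {P : Matrix (Fin k) (Fin k) K}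
    (hP : nonIsotropic P) {y : Fin k → K} (hy : y ≠ 0) (z : Fin k → K) :
    ∃ A ∈ altSet K k, ∃ c : K, (P * A).mulVec y + c • y = z := by
  have hdet := (Matrix.isUnit_iff_isUnit_det P).1 hP.isUnit
  have hy' : y ⬝ᵥ P⁻¹.mulVec y ≠ 0 := hP.inv y hy
  obtain ⟨c, hc⟩ : ∃ c, c = (y ⬝ᵥ P⁻¹.mulVec z) / (y ⬝ᵥ P⁻¹.mulVec y) := ⟨_, rfl⟩
  obtain ⟨A, hA, h⟩ := exists_mem_altSet_mulVec_eq (y := P⁻¹.mulVec (z - c • y)) hy (by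
    rw [mulVec_sub, mulVec_smul, dotProduct_sub, dotProduct_smul, hc, smul_eq_mul,
      div_mul_cancel₀ _ hy', sub_self])
  refine ⟨A, hA, c, ?_⟩
  rw [← mulVec_mulVec, h, mulVec_mulVec, mul_nonsing_inv P hdet, one_mulVec, sub_add_cancel]

theorem fromBlocks_mulVec_elim_zero {m n p q : Type*} [Fintype m] [Fintype n] (A : Matrix p m K)
    (B : Matrix p n K) (C : Matrix q m K) (D : Matrix q n K) (x : m → K) :
    (fromBlocks A B C D).mulVec (Sum.elim x 0) = Sum.elim (A.mulVec x) (C.mulVec x) := by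
  rw [fromBlocks_mulVec, Sum.elim_comp_inl, Sum.elim_comp_inr, mulVec_zero, mulVec_zero,
    add_zero, add_zero]

theorem exists_mem_blockUpper_mulVec_eq {m n : Type*} [Fintype m] [Fintype n] [DecidableEq n]
    {S : Set (Matrix m m K)} {T : Set (Matrix n n K)}
    (hS : 0 ∈ S) (hT : 0 ∈ T) {u : m → K} {v : n → K} (hv : v ≠ 0) (y : m → K) :
    ∃ M ∈ blockUpper S T, M.mulVec (Sum.elim u v) = Sum.elim y 0 := by
  obtain ⟨i, hi⟩ := Function.ne_iff.1 hv
  refine ⟨fromBlocks 0 (vecMulVec y (Pi.single i (v i)⁻¹)) 0 0, mem_blockUpper.2 ⟨hS, hT⟩, ?_⟩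
  have hi' : v i ≠ 0 := hi
  rw [fromBlocks_mulVec]
  simp [Function.comp_def, vecMulVec_mulVec, hi']

/-- A change of basis between spaces of block upper-triangular matrices whose first blocks are
`P • Alt` with `P` non-isotropic preserves the subspace attached to the first block. -/
theorem toBlocks₂₁_eq_zero_of_forall_mem {k k' : ℕ} {P : Matrix (Fin k) (Fin k) K}
    {P' : Matrix (Fin k') (Fin k') K} (hk' : 0 < k') (hP : nonIsotropic P)
    {T : Set (Matrix m m K)} {T' : Set (Matrix n n K)} (hT : 0 ∈ T) (hT' : 0 ∈ T')
    {Q : Matrix (Fin k' ⊕ n) (Fin k ⊕ m) K} {Q' : Matrix (Fin k ⊕ m) (Fin k' ⊕ n) K}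
    (h1 : Q * Q' = 1) (h2 : Q' * Q = 1)
    (h : ∀ M, M ∈ blockUpper ((fun A => P * A) '' altSet K k) T ↔
      Q * M * Q' ∈ blockUpper ((fun A => P' * A) '' altSet K k') T') :
    Q.toBlocks₂₁ = 0 := by
  have hinv : ∀ x, Q'.mulVec (Q.mulVec x) = x := fun x => by
    rw [mulVec_mulVec, h2, one_mulVec]
  have hinv' : ∀ x, Q.mulVec (Q'.mulVec x) = x := fun x => by
    rw [mulVec_mulVec, h1, one_mulVec]
  by_contra h0
  obtain ⟨x, hx⟩ : ∃ x, Q.toBlocks₂₁.mulVec x ≠ 0 := by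
    by_contra! hx
    exact h0 (Matrix.mulVec_injective (funext fun x => by rw [hx, zero_mulVec]))
  have hQ : ∀ z, Q.mulVec (Sum.elim z 0) =
      Sum.elim (Q.toBlocks₁₁.mulVec z) (Q.toBlocks₂₁.mulVec z) := fun z => by
    conv_lhs => rw [← fromBlocks_toBlocks Q, fromBlocks_mulVec_elim_zero]
  let y' : Fin k' → K := fun _ => 1
  have hy' : y' ≠ 0 := fun h => one_ne_zero (congrFun h ⟨0, hk'⟩)
  obtain ⟨M, hM, hMx⟩ := exists_mem_blockUpper_mulVec_eq (zero_mem_mul_altSet P') hT'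
    (u := Q.toBlocks₁₁.mulVec x) hx y'
  rw [← hQ] at hMx
  obtain ⟨N, hN⟩ : ∃ N, N = Q' * M * Q := ⟨_, rfl⟩
  have hNM : Q * N * Q' = M := by
    rw [hN]
    simp only [← Matrix.mul_assoc, h1, Matrix.one_mul]
    rw [Matrix.mul_assoc, h1, Matrix.mul_one]
  rw [← hNM, ← h] at hM
  obtain ⟨A, hA, C, hC, B, rfl⟩ := hM
  have hNx : Q'.mulVec (Sum.elim y' 0) = Sum.elim (A.mulVec x) 0 := by
    rw [← hMx, ← hNM, ← mulVec_mulVec, hinv, ← mulVec_mulVec, hinv, fromBlocks_mulVec_elim_zero,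
      zero_mulVec]
  have hAx : A.mulVec x ≠ 0 := by
    intro h3
    rw [h3] at hNx
    have := hinv' (Sum.elim y' 0)
    rw [hNx, Sum.elim_zero_zero, mulVec_zero] at this
    exact hy' (funext fun i => (congrFun this (Sum.inl i)).symm)
  obtain ⟨D, hD, c, hDc⟩ := hP.exists_mulVec_add_smul_eq hAx x
  obtain ⟨A', hA', C', hC', B', h3⟩ := (h (fromBlocks (P * D) 0 0 0)).1
    (mem_blockUpper.2 ⟨⟨D, hD, rfl⟩, hT⟩)
  have h4 : Sum.elim x 0 = (fromBlocks (P * D) 0 0 0).mulVec (Q'.mulVec (Sum.elim y' 0)) +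
      c • Q'.mulVec (Sum.elim y' (0 : n → K)) := by
    rw [hNx, fromBlocks_mulVec_elim_zero, zero_mulVec]
    conv_lhs => rw [← hDc]
    ext (i | i) <;> simp
  have h5 := congrArg Q.mulVec h4
  rw [hQ, mulVec_add, mulVec_smul, hinv', mulVec_mulVec, mulVec_mulVec, h3,
    fromBlocks_mulVec_elim_zero] at h5
  refine hx (funext fun i => ?_)
  simpa using congrFun h5 (Sum.inr i)

theorem ChangeOfBasis.of_blockUpper {k k' : ℕ} {P : Matrix (Fin k) (Fin k) K}
    {P' : Matrix (Fin k') (Fin k') K} (hk : 0 < k) (hk' : 0 < k') (hP : nonIsotropic P)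
    (hP' : nonIsotropic P') {T : Set (Matrix m m K)} {T' : Set (Matrix n n K)}
    (hT : 0 ∈ T) (hT' : 0 ∈ T')
    (h : ChangeOfBasis (_root_.blockUpper ((fun A => P * A) '' altSet K k) T)
      (_root_.blockUpper ((fun A => P' * A) '' altSet K k') T')) :
    ChangeOfBasis ((fun A => P * A) '' altSet K k) ((fun A => P' * A) '' altSet K k') ∧
      ChangeOfBasis T T' := by
  obtain ⟨Q, Q', h1, h2, h⟩ := h
  have h' : ∀ M, M ∈ _root_.blockUpper ((fun A => P' * A) '' altSet K k') T' ↔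
      Q' * M * Q ∈ _root_.blockUpper ((fun A => P * A) '' altSet K k) T := fun M => by
    rw [h]
    simp only [← Matrix.mul_assoc, h1, Matrix.one_mul]
    rw [Matrix.mul_assoc, h1, Matrix.mul_one]
  have hQ := toBlocks₂₁_eq_zero_of_forall_mem hk' hP hT hT' h1 h2 h
  have hQ' := toBlocks₂₁_eq_zero_of_forall_mem hk hP' hT' hT h2 h1 h'
  rw [← fromBlocks_toBlocks Q, ← fromBlocks_toBlocks Q', hQ, hQ', fromBlocks_multiply,
    ← fromBlocks_one] at h1 h2
  simp only [Matrix.mul_zero, Matrix.zero_mul, add_zero, zero_add, fromBlocks_inj] at h1 h2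
  have hconj : ∀ A C, fromBlocks A 0 0 C ∈ _root_.blockUpper ((fun A => P * A) '' altSet K k) T ↔
      Q.toBlocks₁₁ * A * Q'.toBlocks₁₁ ∈ ((fun A => P' * A) '' altSet K k') ∧
        Q.toBlocks₂₂ * C * Q'.toBlocks₂₂ ∈ T' := fun A C => by
    rw [h, ← fromBlocks_toBlocks Q, ← fromBlocks_toBlocks Q', hQ, hQ']
    simp only [fromBlocks_multiply, Matrix.mul_zero, Matrix.zero_mul, add_zero, zero_add,
      mem_blockUpper, toBlocks_fromBlocks₁₁, toBlocks_fromBlocks₂₂]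
  constructor
  · refine ⟨_, _, h1.1, h2.1, fun A => ?_⟩
    simpa [mem_blockUpper, hT, hT'] using hconj A 0
  · refine ⟨_, _, h1.2.2.2, h2.2.2.2, fun C => ?_⟩
    have := hconj 0 C
    rw [mem_blockUpper, Matrix.mul_zero, Matrix.zero_mul] at this
    simpa only [zero_mem_mul_altSet, true_and] using this

theorem eq_smul_one_of_mul_mem_altSet {k : ℕ} (hk : 0 < k) {R : Matrix (Fin k) (Fin k) K}
    (hR : ∀ A ∈ altSet K k, R * A ∈ altSet K k) : ∃ r : K, R = r • 1 := by
  have h1 : ∀ i j X, (X ⬝ᵥ R.mulVec (Pi.single i 1)) * X j =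
      (X ⬝ᵥ R.mulVec (Pi.single j 1)) * X i := fun i j X => by
    have := hR _ (vecMulVec_sub_mem_altSet (Pi.single i 1) (Pi.single j 1)) X
    rw [← mulVec_mulVec, sub_mulVec, vecMulVec_mulVec, vecMulVec_mulVec, mulVec_sub,
      dotProduct_sub, sub_eq_zero] at this
    simpa [mulVec_smul, mul_comm] using this
  have h2 : ∀ i j, i ≠ j → R j i = 0 := fun i j hij => by
    simpa [hij, hij.symm] using h1 i j (Pi.single j 1)
  have h3 : ∀ i j, R i i = R j j := fun i j => by
    rcases eq_or_ne i j with rfl | hij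
    · rfl
    · have := h1 i j (Pi.single i 1 + Pi.single j 1)
      simp only [add_dotProduct] at this
      simpa [hij, hij.symm, h2 i j hij, h2 j i hij.symm] using this
  refine ⟨R ⟨0, hk⟩ ⟨0, hk⟩, ?_⟩
  ext i j
  rcases eq_or_ne i j with rfl | hij
  · simp [h3 i ⟨0, hk⟩]
  · simp [hij, h2 j i hij.symm]

theorem conj_mem_altSet {k k' : ℕ} {A : Matrix (Fin k) (Fin k) K} (hA : A ∈ altSet K k)
    (Q : Matrix (Fin k') (Fin k) K) : Q * A * Qᵀ ∈ altSet K k' := fun X => by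
  rw [← mulVec_mulVec, ← mulVec_mulVec, dotProduct_mulVec, ← mulVec_transpose]
  exact hA _

theorem ChangeOfBasis.congrScalar {k k' : ℕ} {P : Matrix (Fin k) (Fin k) K}
    {P' : Matrix (Fin k') (Fin k') K} (hk : 0 < k) (hP : IsUnit P) (hP' : IsUnit P')
    (h : ChangeOfBasis ((fun A => P * A) '' altSet K k) ((fun A => P' * A) '' altSet K k')) :
    congrScalar ⟨k, P⟩ ⟨k', P'⟩ := by
  obtain rfl : k = k' := h.size_eq
  obtain ⟨Q, Q', h1, h2, h⟩ := h
  have hdet := (Matrix.isUnit_iff_isUnit_det P').1 hP'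
  have hQ : IsUnit Q := IsUnit.of_mul_eq_one _ h1
  obtain ⟨r, hr⟩ := eq_smul_one_of_mul_mem_altSet hk (R := P'⁻¹ * (Q * P * Qᵀ)) fun A hA => by
    have hA' := conj_mem_altSet hA Qᵀ
    rw [transpose_transpose] at hA'
    obtain ⟨B, hB, h3⟩ := (h _).1 ⟨_, hA', rfl⟩
    simp only at h3
    have h4 : P'⁻¹ * (Q * P * Qᵀ) * A = B := by
      rw [← Matrix.one_mul B, ← nonsing_inv_mul P' hdet, Matrix.mul_assoc P'⁻¹ P' B, h3,
        Matrix.mul_assoc]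
      simp only [Matrix.mul_assoc, h1, Matrix.mul_one]
    rwa [h4]
  have hr' : Q * P * Qᵀ = r • P' := by
    rw [← Matrix.one_mul (Q * P * Qᵀ), ← mul_nonsing_inv P' hdet, Matrix.mul_assoc, hr,
      Matrix.mul_smul, Matrix.mul_one]
  have hr0 : r ≠ 0 := by
    rintro rfl
    have hu : IsUnit (Q * P * Qᵀ) := (hQ.mul hP).mul ((Matrix.isUnit_transpose Q).2 hQ)
    have : Nonempty (Fin k) := ⟨⟨0, hk⟩⟩
    rw [hr', zero_smul] at hu
    exact not_isUnit_zero hu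
  refine ⟨rfl, r⁻¹, inv_ne_zero hr0, Q, hQ, ?_⟩
  simp only
  rw [hr', smul_smul, inv_mul_cancel₀ hr0, one_smul]
  rfl

theorem ChangeOfBasis.forall₂_congrScalar :
    ∀ l l' : List (Σ m : ℕ, Matrix (Fin m) (Fin m) K),
      (∀ x ∈ l, 0 < x.1 ∧ IsUnit x.2 ∧ nonIsotropic x.2) →
      (∀ x ∈ l', 0 < x.1 ∧ IsUnit x.2 ∧ nonIsotropic x.2) →
      ChangeOfBasis (bdSet l) (bdSet l') → List.Forall₂ _root_.congrScalar l l'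
  | [], [], _, _, _ => List.Forall₂.nil
  | [], x :: xs, _, hl', h => by
    have h1 := h.size_eq
    have h2 := (hl' x (by simp)).1
    simp only [sigSum] at h1
    omega
  | x :: xs, [], hl, _, h => by
    have h1 := h.size_eq
    have h2 := (hl x (by simp)).1
    simp only [sigSum] at h1
    omega
  | x :: xs, y :: ys, hl, hl', h => by
    obtain ⟨hx, hxs⟩ := List.forall_mem_cons.1 hl
    obtain ⟨hy, hys⟩ := List.forall_mem_cons.1 hl'
    obtain ⟨h1, h2⟩ := ChangeOfBasis.of_blockUpper hx.1 hy.1 hx.2.2 hy.2.2 (zero_mem_bdSet xs)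
      (zero_mem_bdSet ys) (((ChangeOfBasis.reindex_finSumFinEquiv _ _).trans h).trans
        (ChangeOfBasis.reindex_finSumFinEquiv _ _).symm)
    exact .cons (h1.congrScalar hx.1 hx.2.1 hy.2.1)
      (ChangeOfBasis.forall₂_congrScalar xs ys hxs hys h2)

theorem congrScalar.changeOfBasis {x y : Σ m : ℕ, Matrix (Fin m) (Fin m) K}
    (h : congrScalar x y) :
    ChangeOfBasis ((fun A => x.2 * A) '' altSet K x.1) ((fun A => y.2 * A) '' altSet K y.1) := by
  obtain ⟨k, P⟩ := x
  obtain ⟨k', P'⟩ := y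
  obtain ⟨hk, c, hc, (R : Matrix (Fin k) (Fin k) K), hR, h⟩ := h
  simp only at hk
  subst hk
  have hdet := (Matrix.isUnit_iff_isUnit_det R).1 hR
  have h : P' = c • (R * P * Rᵀ) := h
  have h1 := mul_nonsing_inv R hdet
  have h2 := nonsing_inv_mul R hdet
  have h3 : Rᵀ * R⁻¹ᵀ = 1 := by rw [← transpose_mul, h2, transpose_one]
  have hsmul : ∀ (c : K), ∀ A ∈ altSet K k, c • A ∈ altSet K k := fun c A hA X => by
    rw [smul_mulVec, dotProduct_smul, hA, smul_zero]
  refine ⟨R, R⁻¹, h1, h2, fun M => ?_⟩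
  constructor
  · rintro ⟨A, hA, rfl⟩
    refine ⟨_, hsmul c⁻¹ _ (conj_mem_altSet hA R⁻¹ᵀ), ?_⟩
    simp only [h, transpose_transpose, Matrix.smul_mul, Matrix.mul_smul, smul_smul,
      inv_mul_cancel₀ hc, one_smul]
    simp only [Matrix.mul_assoc]
    rw [← Matrix.mul_assoc Rᵀ, h3, Matrix.one_mul]
  · rintro ⟨A, hA, hM⟩
    have h4 := conj_mem_altSet hA Rᵀ
    refine ⟨_, hsmul c _ h4, ?_⟩
    have h5 : M = R⁻¹ * (R * M * R⁻¹) * R := by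
      simp only [← Matrix.mul_assoc, h2, Matrix.one_mul]
      rw [Matrix.mul_assoc, h2, Matrix.mul_one]
    rw [h5, ← hM]
    simp only [h, transpose_transpose, Matrix.smul_mul, Matrix.mul_smul]
    simp only [← Matrix.mul_assoc, h2, Matrix.one_mul]

theorem ChangeOfBasis.bdSet_of_forall₂ {l l' : List (Σ m : ℕ, Matrix (Fin m) (Fin m) K)}
    (h : List.Forall₂ _root_.congrScalar l l') : ChangeOfBasis (bdSet l) (bdSet l') := by
  induction h with
  | nil => exact ⟨1, 1, by simp, by simp, fun M => by simp⟩
  | cons h _ ih =>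
    exact ((ChangeOfBasis.reindex_finSumFinEquiv _ _).symm.trans
      (h.changeOfBasis.blockUpper ih)).trans (ChangeOfBasis.reindex_finSumFinEquiv _ _)

theorem SimilarSets.changeOfBasis {a b : ℕ} {S : Set (Matrix (Fin a) (Fin a) K)}
    {T : Set (Matrix (Fin b) (Fin b) K)} {h : a = b}
    (hST : SimilarSets (reindex (finCongr h) (finCongr h) '' S) T) : ChangeOfBasis S T := by
  subst h
  obtain ⟨P, hP, rfl⟩ := hST
  have hdet := (Matrix.isUnit_iff_isUnit_det P).1 hP
  have h1 := mul_nonsing_inv P hdet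
  have h2 := nonsing_inv_mul P hdet
  have hid : reindex (finCongr rfl) (finCongr rfl) '' S = S := Set.image_id S
  rw [hid]
  refine ⟨P, P⁻¹, h1, h2, fun M => ⟨fun hM => ⟨M, hM, rfl⟩, ?_⟩⟩
  rintro ⟨N, hN, h⟩
  have := congrArg (fun N => P⁻¹ * N * P) h
  simp only [← Matrix.mul_assoc, h2, Matrix.one_mul] at this
  rw [Matrix.mul_assoc, Matrix.mul_assoc, h2, Matrix.mul_one, Matrix.mul_one] at this
  exact this ▸ hN

theorem ChangeOfBasis.similarSets {a b : ℕ} {S : Set (Matrix (Fin a) (Fin a) K)}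
    {T : Set (Matrix (Fin b) (Fin b) K)} (hST : ChangeOfBasis S T) :
    ∃ h : a = b, SimilarSets (reindex (finCongr h) (finCongr h) '' S) T := by
  obtain rfl : a = b := hST.size_eq
  obtain ⟨Q, Q', h1, h2, h⟩ := hST
  have hid : reindex (finCongr rfl) (finCongr rfl) '' S = S := Set.image_id S
  refine ⟨rfl, Q, IsUnit.of_mul_eq_one _ h1, ?_⟩
  rw [hid, inv_eq_right_inv h1]
  ext M
  constructor
  · intro hM
    have h3 : Q * (Q' * M * Q) * Q' = M := by
      simp only [← Matrix.mul_assoc, h1, Matrix.one_mul]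
      rw [Matrix.mul_assoc, h1, Matrix.mul_one]
    exact ⟨Q' * M * Q, (h _).2 (h3.symm ▸ hM), h3⟩
  · rintro ⟨N, hN, rfl⟩
    exact (h N).1 hN

end Uniqueness

theorem exists_ne_zero_ne_one_of_three_le {K : Type*} [Field K] (hK : 3 ≤ Cardinal.mk K) :
    ∃ a : K, a ≠ 0 ∧ a ≠ 1 := by
  by_contra! h
  have h1 : (Set.univ : Set K) ⊆ {0, 1} := fun a _ => or_iff_not_imp_left.2 (h a)
  have h2 := (Cardinal.mk_le_mk_of_subset h1).trans Cardinal.mk_insert_le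
  rw [Cardinal.mk_univ, Cardinal.mk_singleton] at h2
  have := hK.trans h2
  norm_num at this

/-- Classification theorem for maximal linear subspaces with a trivial spectrum.
Assume `|K| ≥ 3` and let `V` be a linear subspace of `M_n(K)` with trivial spectrum and
dimension `n(n-1)/2`.  Then: (1) `V` is similar to some
`P_1·Alt_{n_1}(K) ∨ ⋯ ∨ P_p·Alt_{n_p}(K)` with all `P_k` invertible and non-isotropic;
(2) the list `(n_1, P_1), …, (n_p, P_p)` is unique up to blockwise congruence and
multiplication by non-zero scalars; (3) conversely, replacing each `P_k` by any matrix
congruent to a non-zero scalar multiple of it again yields a space similar to `V`. -/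
theorem classification_trivialSpectrum (K : Type*) [Field K] (hK : 3 ≤ Cardinal.mk K)
    (n : ℕ) (V : Submodule K (Matrix (Fin n) (Fin n) K))
    (htriv : TrivialSpectrum (V : Set (Matrix (Fin n) (Fin n) K)))
    (hdim : Module.finrank K V = n * (n - 1) / 2) :
    (∃ l : List (Σ m : ℕ, Matrix (Fin m) (Fin m) K), Represents V l) ∧
    (∀ l l' : List (Σ m : ℕ, Matrix (Fin m) (Fin m) K),
      Represents V l → Represents V l' → List.Forall₂ congrScalar l l') ∧
    (∀ l l' : List (Σ m : ℕ, Matrix (Fin m) (Fin m) K),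
      Represents V l → (∀ x ∈ l', IsUnit x.2) → List.Forall₂ congrScalar l l' →
      ∃ h : sigSum l' = n,
        SimilarSets ((Matrix.reindex (finCongr h) (finCongr h)) '' bdSet l')
          (V : Set (Matrix (Fin n) (Fin n) K))) := by
  refine ⟨exists_represents (exists_ne_zero_ne_one_of_three_le hK) V htriv hdim, ?_, ?_⟩
  · rintro l l' ⟨hl, h, hs⟩ ⟨hl', h', hs'⟩
    exact ChangeOfBasis.forall₂_congrScalar l l' hl hl'
      (hs.changeOfBasis.trans hs'.changeOfBasis.symm)
  · rintro l l' ⟨-, h, hs⟩ - hll'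
    exact ((ChangeOfBasis.bdSet_of_forall₂ hll').symm.trans hs.changeOfBasis).similarSets
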